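/- arXiv:2012.08370 — 3 statements merged into one kernel-verified Lean document; each statement's English description precedes it below -/
import Mathlib

section
/- (Operator-extension step of the initiality theorem.) Let Σ be a valid signature such that CwF_Σ has an initial object, let Γ be a uniform family of contexts over CwF_Σ, and let A be a uniform family of types over Γ. Then the category CwF_{Σ'} for the extended signature Σ' = (Σ,(Γ,A,f)) — whose objects are pairs (C,f_C) with C an object of CwF_Σ and f_C ∈ Tm_C(Γ_C,A_C), and whose morphisms are those F of CwF_Σ with F(f_C) = f_D — has an initial object. -/
universe u v w x u' v' w' x'

/-- A category with families (cwf): a category of contexts and substitutions,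
a `Fam`-valued presheaf of types and terms, a chosen terminal object, and
context comprehension. -/
structure CwF where
  Ctx : Type u
  Hom : Ctx → Ctx → Type v
  id : (Γ : Ctx) → Hom Γ Γ
  comp : {Ξ Δ Γ : Ctx} → Hom Δ Γ → Hom Ξ Δ → Hom Ξ Γ
  id_comp : ∀ {Δ Γ : Ctx} (γ : Hom Δ Γ), comp (id Γ) γ = γ
  comp_id : ∀ {Δ Γ : Ctx} (γ : Hom Δ Γ), comp γ (id Δ) = γ
  comp_assoc : ∀ {Θ Ξ Δ Γ : Ctx} (γ : Hom Δ Γ) (δ : Hom Ξ Δ) (ξ : Hom Θ Ξ),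
    comp (comp γ δ) ξ = comp γ (comp δ ξ)
  Ty : Ctx → Type w
  Tm : (Γ : Ctx) → Ty Γ → Type x
  subTy : {Δ Γ : Ctx} → Ty Γ → Hom Δ Γ → Ty Δ
  subTm : {Δ Γ : Ctx} → {A : Ty Γ} → Tm Γ A → (γ : Hom Δ Γ) → Tm Δ (subTy A γ)
  subTy_id : ∀ {Γ : Ctx} (A : Ty Γ), subTy A (id Γ) = A
  subTy_comp : ∀ {Ξ Δ Γ : Ctx} (A : Ty Γ) (γ : Hom Δ Γ) (δ : Hom Ξ Δ),
    subTy A (comp γ δ) = subTy (subTy A γ) δ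
  subTm_id : ∀ {Γ : Ctx} {A : Ty Γ} (a : Tm Γ A), HEq (subTm a (id Γ)) a
  subTm_comp : ∀ {Ξ Δ Γ : Ctx} {A : Ty Γ} (a : Tm Γ A) (γ : Hom Δ Γ) (δ : Hom Ξ Δ),
    HEq (subTm a (comp γ δ)) (subTm (subTm a γ) δ)
  one : Ctx
  bang : (Γ : Ctx) → Hom Γ one
  bang_unique : ∀ {Γ : Ctx} (γ : Hom Γ one), γ = bang Γ
  ext : (Γ : Ctx) → Ty Γ → Ctx
  p : {Γ : Ctx} → (A : Ty Γ) → Hom (ext Γ A) Γ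
  q : {Γ : Ctx} → (A : Ty Γ) → Tm (ext Γ A) (subTy A (p A))
  pair : {Δ Γ : Ctx} → (A : Ty Γ) → (γ : Hom Δ Γ) → Tm Δ (subTy A γ) → Hom Δ (ext Γ A)
  p_pair : ∀ {Δ Γ : Ctx} (A : Ty Γ) (γ : Hom Δ Γ) (a : Tm Δ (subTy A γ)),
    comp (p A) (pair A γ a) = γ
  q_pair : ∀ {Δ Γ : Ctx} (A : Ty Γ) (γ : Hom Δ Γ) (a : Tm Δ (subTy A γ)),
    HEq (subTm (q A) (pair A γ a)) a
  pair_unique : ∀ {Δ Γ : Ctx} (A : Ty Γ) (γ : Hom Δ Γ) (a : Tm Δ (subTy A γ))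
    (δ : Hom Δ (ext Γ A)), comp (p A) δ = γ → HEq (subTm (q A) δ) a → δ = pair A γ a

/-- A strict cwf-morphism: a functor together with a natural transformation of
`Fam`-valued presheaves, preserving the terminal object and context comprehension
on the nose. -/
structure CwFHom (C : CwF.{u, v, w, x}) (D : CwF.{u', v', w', x'}) where
  obj : C.Ctx → D.Ctx
  map : {Δ Γ : C.Ctx} → C.Hom Δ Γ → D.Hom (obj Δ) (obj Γ)
  map_id : ∀ Γ : C.Ctx, map (C.id Γ) = D.id (obj Γ)
  map_comp : ∀ {Ξ Δ Γ : C.Ctx} (γ : C.Hom Δ Γ) (δ : C.Hom Ξ Δ),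
    map (C.comp γ δ) = D.comp (map γ) (map δ)
  mapTy : {Γ : C.Ctx} → C.Ty Γ → D.Ty (obj Γ)
  mapTm : {Γ : C.Ctx} → {A : C.Ty Γ} → C.Tm Γ A → D.Tm (obj Γ) (mapTy A)
  mapTy_sub : ∀ {Δ Γ : C.Ctx} (A : C.Ty Γ) (γ : C.Hom Δ Γ),
    mapTy (C.subTy A γ) = D.subTy (mapTy A) (map γ)
  mapTm_sub : ∀ {Δ Γ : C.Ctx} {A : C.Ty Γ} (a : C.Tm Γ A) (γ : C.Hom Δ Γ),
    HEq (mapTm (C.subTm a γ)) (D.subTm (mapTm a) (map γ))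
  obj_one : obj C.one = D.one
  obj_ext : ∀ {Γ : C.Ctx} (A : C.Ty Γ), obj (C.ext Γ A) = D.ext (obj Γ) (mapTy A)
  map_p : ∀ {Γ : C.Ctx} (A : C.Ty Γ), HEq (map (C.p A)) (D.p (mapTy A))
  map_q : ∀ {Γ : C.Ctx} (A : C.Ty Γ), HEq (mapTm (C.q A)) (D.q (mapTy A))

/-- A "category of cwfs with structure": a collection of objects, each with an
underlying small cwf, together with a predicate singling out which strict
cwf-morphisms of underlying cwfs are structure-preserving morphisms.
The categories `CwF_Σ` of cwfs with a `Σ`-structure are of this shape. -/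
structure SigCat : Type (u + 2) where
  Obj : Type (u + 1)
  cwf : Obj → CwF.{u, u, u, u}
  Mor : (C D : Obj) → CwFHom (cwf C) (cwf D) → Prop

/-- A uniform family of contexts: a choice of context `Γ_C` in each cwf with
structure `C`, preserved on the nose by all structure-preserving morphisms. -/
structure UnifCtx (S : SigCat.{u}) : Type (u + 1) where
  fam : (C : S.Obj) → (S.cwf C).Ctx
  uniform : ∀ {C D : S.Obj} (F : CwFHom (S.cwf C) (S.cwf D)),
    S.Mor C D F → F.obj (fam C) = fam D

/-- A uniform family of types over a uniform family of contexts. -/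
structure UnifTy (S : SigCat.{u}) (Γ : UnifCtx S) : Type (u + 1) where
  fam : (C : S.Obj) → (S.cwf C).Ty (Γ.fam C)
  uniform : ∀ {C D : S.Obj} (F : CwFHom (S.cwf C) (S.cwf D)),
    S.Mor C D F → HEq (F.mapTy (fam C)) (fam D)

/-- A uniform family of terms of a uniform family of types. -/
structure UnifTm (S : SigCat.{u}) (Γ : UnifCtx S) (A : UnifTy S Γ) : Type (u + 1) where
  fam : (C : S.Obj) → (S.cwf C).Tm (Γ.fam C) (A.fam C)
  uniform : ∀ {C D : S.Obj} (F : CwFHom (S.cwf C) (S.cwf D)),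
    S.Mor C D F → HEq (F.mapTm (fam C)) (fam D)

/-- The category of models of the empty signature: `CwF_∅ = CwF`. -/
def SigCat.empty : SigCat.{u} where
  Obj := CwF.{u, u, u, u}
  cwf := fun C => C
  Mor := fun _ _ _ => True

/-- Extending a signature by a new sort symbol `S` relative to a uniform family
of contexts `Γ`: objects are pairs `(C, S_C)` with `S_C ∈ Ty_C(Γ_C)`, and
morphisms are those `F` with `F(S_C) = S_D`. -/
def SigCat.addSort (S : SigCat.{u}) (Γ : UnifCtx S) : SigCat.{u} where
  Obj := Σ C : S.Obj, (S.cwf C).Ty (Γ.fam C)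
  cwf := fun C => S.cwf C.1
  Mor := fun C D F => S.Mor C.1 D.1 F ∧ HEq (F.mapTy C.2) D.2

/-- Extending a signature by a new operator symbol `f` relative to a uniform
family of contexts `Γ` and a uniform family of types `A`: objects are pairs
`(C, f_C)` with `f_C ∈ Tm_C(Γ_C, A_C)`, and morphisms are those `F` with
`F(f_C) = f_D`. -/
def SigCat.addOp (S : SigCat.{u}) (Γ : UnifCtx S) (A : UnifTy S Γ) : SigCat.{u} where
  Obj := Σ C : S.Obj, (S.cwf C).Tm (Γ.fam C) (A.fam C)
  cwf := fun C => S.cwf C.1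
  Mor := fun C D F => S.Mor C.1 D.1 F ∧ HEq (F.mapTm C.2) D.2

/-- Extending a signature by a new equation `a = a'` between uniform families
of terms: the full subcategory of objects `C` with `a_C = a'_C`. -/
def SigCat.addEq (S : SigCat.{u}) (Γ : UnifCtx S) (A : UnifTy S Γ)
    (a a' : UnifTm S Γ A) : SigCat.{u} where
  Obj := { C : S.Obj // a.fam C = a'.fam C }
  cwf := fun C => S.cwf C.1
  Mor := fun C D F => S.Mor C.1 D.1 F

/-- Valid signatures, presented via their categories of models: the inductive
closure of `CwF_∅ = CwF` under extension by sort symbols, operator symbols and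
equations relative to uniform families. -/
inductive SigCat.Valid : SigCat.{u} → Prop
  | empty : SigCat.Valid SigCat.empty
  | addSort (S : SigCat.{u}) (Γ : UnifCtx S) :
      SigCat.Valid S → SigCat.Valid (S.addSort Γ)
  | addOp (S : SigCat.{u}) (Γ : UnifCtx S) (A : UnifTy S Γ) :
      SigCat.Valid S → SigCat.Valid (S.addOp Γ A)
  | addEq (S : SigCat.{u}) (Γ : UnifCtx S) (A : UnifTy S Γ) (a a' : UnifTm S Γ A) :
      SigCat.Valid S → SigCat.Valid (S.addEq Γ A a a')

/-- `I` is an initial object of the category of cwfs with structure `S`: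
to every object there is a unique structure-preserving strict cwf-morphism
from `I`. -/
def SigCat.IsInitial (S : SigCat.{u}) (I : S.Obj) : Prop :=
  ∀ C : S.Obj, ∃! F : CwFHom (S.cwf I) (S.cwf C), S.Mor I C F

/-! ### Elements of a cwf, untyped -/

/-- The disjoint union of all contexts, substitutions, types and terms of a cwf. -/
inductive Elt (C : CwF.{u, u, u, u}) : Type u
  | ctx (Γ : C.Ctx) : Elt C
  | hom (Δ Γ : C.Ctx) (γ : C.Hom Δ Γ) : Elt C
  | ty (Γ : C.Ctx) (A : C.Ty Γ) : Elt C
  | tm (Γ : C.Ctx) (A : C.Ty Γ) (a : C.Tm Γ A) : Elt C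

/-- Action of a strict morphism on elements. -/
def Elt.map {C : CwF.{u, u, u, u}} {D : CwF.{v, v, v, v}} (F : CwFHom C D) : Elt C → Elt D
  | .ctx Γ => .ctx (F.obj Γ)
  | .hom _ _ γ => .hom _ _ (F.map γ)
  | .ty _ A => .ty _ (F.mapTy A)
  | .tm _ _ a => .tm _ _ (F.mapTm a)

section congruence

variable {C : CwF.{u, v, w, x}}

theorem CwF.comp_heq {Ξ Δ Γ Ξ' Δ' Γ' : C.Ctx} {γ : C.Hom Δ Γ} {δ : C.Hom Ξ Δ}
    {γ' : C.Hom Δ' Γ'} {δ' : C.Hom Ξ' Δ'} (h1 : Ξ = Ξ') (h2 : Δ = Δ') (h3 : Γ = Γ')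
    (h4 : HEq γ γ') (h5 : HEq δ δ') : HEq (C.comp γ δ) (C.comp γ' δ') := by
  subst h1 h2 h3 h4 h5; rfl

theorem CwF.subTy_heq {Δ Γ Δ' Γ' : C.Ctx} {A : C.Ty Γ} {A' : C.Ty Γ'} {γ : C.Hom Δ Γ}
    {γ' : C.Hom Δ' Γ'} (h2 : Δ = Δ') (h3 : Γ = Γ')
    (h4 : HEq A A') (h5 : HEq γ γ') : HEq (C.subTy A γ) (C.subTy A' γ') := by
  subst h2 h3 h4 h5; rfl

theorem CwF.subTm_heq {Δ Γ Δ' Γ' : C.Ctx} {A : C.Ty Γ} {A' : C.Ty Γ'} {a : C.Tm Γ A}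
    {a' : C.Tm Γ' A'} {γ : C.Hom Δ Γ} {γ' : C.Hom Δ' Γ'} (h2 : Δ = Δ') (h3 : Γ = Γ')
    (h4 : HEq A A') (h6 : HEq a a') (h5 : HEq γ γ') :
    HEq (C.subTm a γ) (C.subTm a' γ') := by
  subst h2 h3 h4 h5 h6; rfl

theorem CwF.ext_congr {Γ Γ' : C.Ctx} {A : C.Ty Γ} {A' : C.Ty Γ'} (h3 : Γ = Γ')
    (h4 : HEq A A') : C.ext Γ A = C.ext Γ' A' := by
  subst h3 h4; rfl

theorem CwF.p_heq {Γ Γ' : C.Ctx} {A : C.Ty Γ} {A' : C.Ty Γ'} (h3 : Γ = Γ')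
    (h4 : HEq A A') : HEq (C.p A) (C.p A') := by
  subst h3 h4; rfl

theorem CwF.q_heq {Γ Γ' : C.Ctx} {A : C.Ty Γ} {A' : C.Ty Γ'} (h3 : Γ = Γ')
    (h4 : HEq A A') : HEq (C.q A) (C.q A') := by
  subst h3 h4; rfl

theorem CwF.pair_heq {Δ Γ Δ' Γ' : C.Ctx} {A : C.Ty Γ} {A' : C.Ty Γ'} {γ : C.Hom Δ Γ}
    {γ' : C.Hom Δ' Γ'} {a : C.Tm Δ (C.subTy A γ)} {a' : C.Tm Δ' (C.subTy A' γ')}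
    (h2 : Δ = Δ') (h3 : Γ = Γ') (h4 : HEq A A') (h5 : HEq γ γ') (h6 : HEq a a') :
    HEq (C.pair A γ a) (C.pair A' γ' a') := by
  subst h2 h3 h4 h5 h6; rfl

/-- A heterogeneous form of the uniqueness of pairing. -/
theorem CwF.pair_unique_heq {Δ Γ X : C.Ctx} (A : C.Ty Γ) (γ : C.Hom Δ Γ)
    (a : C.Tm Δ (C.subTy A γ)) (hX : X = C.ext Γ A) (p' : C.Hom X Γ) (hp : HEq p' (C.p A))
    (B : C.Ty X) (hB : HEq B (C.subTy A (C.p A))) (q' : C.Tm X B) (hq : HEq q' (C.q A))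
    (δ : C.Hom Δ X) (h1 : C.comp p' δ = γ) (h2 : HEq (C.subTm q' δ) a) :
    HEq δ (C.pair A γ a) := by
  subst hX hp hB hq
  exact heq_of_eq (C.pair_unique A γ a δ h1 h2)

end congruence

section homs

/-- Composition of strict morphisms. -/
def CwFHom.trans {C : CwF.{u, u, u, u}} {D : CwF.{v, v, v, v}} {E : CwF.{w, w, w, w}}
    (F : CwFHom C D) (G : CwFHom D E) : CwFHom C E where
  obj Γ := G.obj (F.obj Γ)
  map γ := G.map (F.map γ)
  map_id Γ := by rw [F.map_id, G.map_id]
  map_comp γ δ := by rw [F.map_comp, G.map_comp]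
  mapTy A := G.mapTy (F.mapTy A)
  mapTm a := G.mapTm (F.mapTm a)
  mapTy_sub A γ := by rw [F.mapTy_sub, G.mapTy_sub]
  mapTm_sub {_ _ A} a γ := by
    refine HEq.trans ?_ (G.mapTm_sub _ _)
    have h := F.mapTm_sub a γ
    have h' := F.mapTy_sub A γ
    congr 1
  obj_one := by rw [F.obj_one, G.obj_one]
  obj_ext A := by rw [F.obj_ext, G.obj_ext]
  map_p A := by
    refine HEq.trans ?_ (G.map_p _)
    have h := F.map_p A
    have h' := F.obj_ext A
    congr 1
  map_q A := by
    refine HEq.trans ?_ (G.map_q _)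
    have h := F.map_q A
    have h' := F.obj_ext A
    have h'' := F.mapTy_sub A (C.p A)
    have h3 : HEq (F.mapTy (C.subTy A (C.p A))) (D.subTy (F.mapTy A) (D.p (F.mapTy A))) :=
      (heq_of_eq h'').trans (CwF.subTy_heq h' rfl HEq.rfl (F.map_p A))
    congr 1

theorem Elt.map_trans {C : CwF.{u, u, u, u}} {D : CwF.{v, v, v, v}} {E : CwF.{w, w, w, w}}
    (F : CwFHom C D) (G : CwFHom D E) (e : Elt C) :
    Elt.map (F.trans G) e = Elt.map G (Elt.map F e) := by
  cases e <;> rfl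

theorem CwFHom.ext_elt {C : CwF.{u, u, u, u}} {D : CwF.{v, v, v, v}} (F G : CwFHom C D)
    (h : ∀ e, Elt.map F e = Elt.map G e) : F = G := by
  have h1 : F.obj = G.obj := by
    funext Γ
    have := h (.ctx Γ)
    simpa [Elt.map] using this
  have h2 : ∀ Δ Γ (γ : C.Hom Δ Γ), HEq (F.map γ) (G.map γ) := by
    intro Δ Γ γ
    have := h (.hom _ _ γ)
    simp only [Elt.map, Elt.hom.injEq] at this
    exact this.2.2
  have h3 : ∀ Γ (A : C.Ty Γ), HEq (F.mapTy A) (G.mapTy A) := by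
    intro Γ A
    have := h (.ty _ A)
    simp only [Elt.map, Elt.ty.injEq] at this
    exact this.2
  have h4 : ∀ Γ (A : C.Ty Γ) (a : C.Tm Γ A), HEq (F.mapTm a) (G.mapTm a) := by
    intro Γ A a
    have := h (.tm _ _ a)
    simp only [Elt.map, Elt.tm.injEq] at this
    exact this.2.2
  clear h
  cases F with
  | mk o m _ _ t s _ _ _ _ _ _ =>
  cases G with
  | mk o' m' _ _ t' s' _ _ _ _ _ _ =>
  simp only at h1 h2 h3 h4
  subst h1
  have : @m = @m' := by
    funext Δ Γ γ
    exact eq_of_heq (h2 _ _ γ)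
  subst this
  have : @t = @t' := by
    funext Γ A
    exact eq_of_heq (h3 _ A)
  subst this
  have : @s = @s' := by
    funext Γ A a
    exact eq_of_heq (h4 _ _ a)
  subst this
  rfl

theorem CwFHom.map_bang {C : CwF.{u, u, u, u}} {D : CwF.{v, v, v, v}} (F : CwFHom C D)
    (Γ : C.Ctx) : HEq (F.map (C.bang Γ)) (D.bang (F.obj Γ)) := by
  have key : ∀ (X : D.Ctx) (_ : X = D.one) (f : D.Hom (F.obj Γ) X), HEq f (D.bang (F.obj Γ)) := by
    intro X hX f
    subst hX
    exact heq_of_eq (D.bang_unique f)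
  exact key _ F.obj_one _

theorem CwFHom.map_pair {C : CwF.{u, u, u, u}} {D : CwF.{v, v, v, v}} (F : CwFHom C D)
    {Δ Γ : C.Ctx} (A : C.Ty Γ) (γ : C.Hom Δ Γ) (a : C.Tm Δ (C.subTy A γ))
    (a' : D.Tm (F.obj Δ) (D.subTy (F.mapTy A) (F.map γ))) (ha : HEq (F.mapTm a) a') :
    HEq (F.map (C.pair A γ a)) (D.pair (F.mapTy A) (F.map γ) a') := by
  refine CwF.pair_unique_heq (F.mapTy A) (F.map γ) a' (F.obj_ext A) (F.map (C.p A)) (F.map_p A)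
    (F.mapTy (C.subTy A (C.p A))) ?_ (F.mapTm (C.q A)) (F.map_q A) _ ?_ ?_
  · exact (heq_of_eq (F.mapTy_sub A (C.p A))).trans
      (CwF.subTy_heq (F.obj_ext A) rfl HEq.rfl (F.map_p A))
  · rw [← F.map_comp, C.p_pair]
  · refine (F.mapTm_sub _ _).symm.trans (HEq.trans ?_ ha)
    have h1 := C.q_pair A γ a
    have h2 : C.subTy (C.subTy A (C.p A)) (C.pair A γ a) = C.subTy A γ := by
      rw [← C.subTy_comp, C.p_pair]
    congr 1

end homs

section gen

/-- The sub-cwf generated by a family of elements. -/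
inductive Gen (P : CwF.{u, u, u, u}) {N : Type v} (g : N → Elt P) : Elt P → Prop
  | gen (n : N) : Gen P g (g n)
  | one : Gen P g (.ctx P.one)
  | id (Γ : P.Ctx) : Gen P g (.ctx Γ) → Gen P g (.hom _ _ (P.id Γ))
  | comp {Ξ Δ Γ : P.Ctx} (γ : P.Hom Δ Γ) (δ : P.Hom Ξ Δ) :
      Gen P g (.hom _ _ γ) → Gen P g (.hom _ _ δ) → Gen P g (.hom _ _ (P.comp γ δ))
  | subTy {Δ Γ : P.Ctx} (A : P.Ty Γ) (γ : P.Hom Δ Γ) :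
      Gen P g (.ty _ A) → Gen P g (.hom _ _ γ) → Gen P g (.ty _ (P.subTy A γ))
  | subTm {Δ Γ : P.Ctx} {A : P.Ty Γ} (a : P.Tm Γ A) (γ : P.Hom Δ Γ) :
      Gen P g (.tm _ _ a) → Gen P g (.hom _ _ γ) → Gen P g (.tm _ _ (P.subTm a γ))
  | bang (Γ : P.Ctx) : Gen P g (.ctx Γ) → Gen P g (.hom _ _ (P.bang Γ))
  | ext {Γ : P.Ctx} (A : P.Ty Γ) : Gen P g (.ty _ A) → Gen P g (.ctx (P.ext Γ A))
  | p {Γ : P.Ctx} (A : P.Ty Γ) : Gen P g (.ty _ A) → Gen P g (.hom _ _ (P.p A))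
  | q {Γ : P.Ctx} (A : P.Ty Γ) : Gen P g (.ty _ A) → Gen P g (.tm _ _ (P.q A))
  | pair {Δ Γ : P.Ctx} (A : P.Ty Γ) (γ : P.Hom Δ Γ) (a : P.Tm Δ (P.subTy A γ)) :
      Gen P g (.ty _ A) → Gen P g (.hom _ _ γ) → Gen P g (.tm _ _ a) →
      Gen P g (.hom _ _ (P.pair A γ a))
  | homDom {Δ Γ : P.Ctx} (γ : P.Hom Δ Γ) : Gen P g (.hom _ _ γ) → Gen P g (.ctx Δ)
  | homCod {Δ Γ : P.Ctx} (γ : P.Hom Δ Γ) : Gen P g (.hom _ _ γ) → Gen P g (.ctx Γ)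
  | tyCtx {Γ : P.Ctx} (A : P.Ty Γ) : Gen P g (.ty _ A) → Gen P g (.ctx Γ)
  | tmTy {Γ : P.Ctx} {A : P.Ty Γ} (a : P.Tm Γ A) : Gen P g (.tm _ _ a) → Gen P g (.ty _ A)

/-- Names of operations. -/
inductive OpName : Type
  | one | id | comp | subTy | subTm | bang | ext | p | q | pair | homDom | homCod | tyCtx | tmTy

/-- Graph of the operations on untyped elements. -/
inductive OpRel (P : CwF.{u, u, u, u}) : OpName → Elt P → Elt P → Elt P → Elt P → Prop
  | one (x y z : Elt P) : OpRel P .one x y z (.ctx P.one)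
  | id (Γ : P.Ctx) (y z : Elt P) : OpRel P .id (.ctx Γ) y z (.hom _ _ (P.id Γ))
  | comp {Ξ Δ Γ : P.Ctx} (γ : P.Hom Δ Γ) (δ : P.Hom Ξ Δ) (z : Elt P) :
      OpRel P .comp (.hom _ _ γ) (.hom _ _ δ) z (.hom _ _ (P.comp γ δ))
  | subTy {Δ Γ : P.Ctx} (A : P.Ty Γ) (γ : P.Hom Δ Γ) (z : Elt P) :
      OpRel P .subTy (.ty _ A) (.hom _ _ γ) z (.ty _ (P.subTy A γ))
  | subTm {Δ Γ : P.Ctx} {A : P.Ty Γ} (a : P.Tm Γ A) (γ : P.Hom Δ Γ) (z : Elt P) :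
      OpRel P .subTm (.tm _ _ a) (.hom _ _ γ) z (.tm _ _ (P.subTm a γ))
  | bang (Γ : P.Ctx) (y z : Elt P) : OpRel P .bang (.ctx Γ) y z (.hom _ _ (P.bang Γ))
  | ext {Γ : P.Ctx} (A : P.Ty Γ) (y z : Elt P) :
      OpRel P .ext (.ty _ A) y z (.ctx (P.ext Γ A))
  | p {Γ : P.Ctx} (A : P.Ty Γ) (y z : Elt P) : OpRel P .p (.ty _ A) y z (.hom _ _ (P.p A))
  | q {Γ : P.Ctx} (A : P.Ty Γ) (y z : Elt P) : OpRel P .q (.ty _ A) y z (.tm _ _ (P.q A))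
  | pair {Δ Γ : P.Ctx} (A : P.Ty Γ) (γ : P.Hom Δ Γ) (a : P.Tm Δ (P.subTy A γ)) :
      OpRel P .pair (.ty _ A) (.hom _ _ γ) (.tm _ _ a) (.hom _ _ (P.pair A γ a))
  | homDom {Δ Γ : P.Ctx} (γ : P.Hom Δ Γ) (y z : Elt P) :
      OpRel P .homDom (.hom _ _ γ) y z (.ctx Δ)
  | homCod {Δ Γ : P.Ctx} (γ : P.Hom Δ Γ) (y z : Elt P) :
      OpRel P .homCod (.hom _ _ γ) y z (.ctx Γ)
  | tyCtx {Γ : P.Ctx} (A : P.Ty Γ) (y z : Elt P) : OpRel P .tyCtx (.ty _ A) y z (.ctx Γ)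
  | tmTy {Γ : P.Ctx} {A : P.Ty Γ} (a : P.Tm Γ A) (y z : Elt P) :
      OpRel P .tmTy (.tm _ _ a) y z (.ty _ A)

theorem OpRel.functional {P : CwF.{u, u, u, u}} {o : OpName} {x y z r r' : Elt P}
    (h : OpRel P o x y z r) (h' : OpRel P o x y z r') : r = r' := by
  cases h <;> cases h' <;> rfl

/-- Untyped codes for elements. -/
inductive Code (N : Type v) : Type v
  | gen (n : N) : Code N
  | op (o : OpName) (a b c : Code N) : Code N

open Classical in
/-- Evaluation of codes (with a default value for ill-typed codes). -/
noncomputable def Code.eval {P : CwF.{u, u, u, u}} {N : Type v} (g : N → Elt P) :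
    Code N → Elt P
  | .gen n => g n
  | .op o a b c =>
    if h : ∃ r, OpRel P o (a.eval g) (b.eval g) (c.eval g) r then h.choose else .ctx P.one

theorem Code.eval_op {P : CwF.{u, u, u, u}} {N : Type v} (g : N → Elt P) {o : OpName}
    {a b c : Code N} {r : Elt P} (h : OpRel P o (a.eval g) (b.eval g) (c.eval g) r) :
    (Code.op o a b c).eval g = r := by
  have h' : ∃ r, OpRel P o (a.eval g) (b.eval g) (c.eval g) r := ⟨r, h⟩
  rw [Code.eval, dif_pos h']
  exact h'.choose_spec.functional h

theorem Gen.exists_code {P : CwF.{u, u, u, u}} {N : Type v} [hN : Nonempty N] (g : N → Elt P)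
    {e : Elt P} (h : Gen P g e) : ∃ c : Code N, c.eval g = e := by
  obtain ⟨n₀⟩ := hN
  have d : Code N := .gen n₀
  have op1 : ∀ {x r : Elt P} (o : OpName), (∃ c : Code N, c.eval g = x) →
      (∀ y z, OpRel P o x y z r) → ∃ c : Code N, c.eval g = r := by
    rintro x r o ⟨c, rfl⟩ h
    exact ⟨.op o c d d, Code.eval_op g (h _ _)⟩
  have op2 : ∀ {x y r : Elt P} (o : OpName), (∃ c : Code N, c.eval g = x) →
      (∃ c : Code N, c.eval g = y) →
      (∀ z, OpRel P o x y z r) → ∃ c : Code N, c.eval g = r := by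
    rintro x y r o ⟨c, rfl⟩ ⟨c', rfl⟩ h
    exact ⟨.op o c c' d, Code.eval_op g (h _)⟩
  induction h with
  | gen n => exact ⟨.gen n, rfl⟩
  | one => exact ⟨.op .one d d d, Code.eval_op g (.one _ _ _)⟩
  | id Γ _ ih => exact op1 .id ih (.id Γ)
  | comp γ δ _ _ ih1 ih2 => exact op2 .comp ih1 ih2 (.comp γ δ)
  | subTy A γ _ _ ih1 ih2 => exact op2 .subTy ih1 ih2 (.subTy A γ)
  | subTm a γ _ _ ih1 ih2 => exact op2 .subTm ih1 ih2 (.subTm a γ)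
  | bang Γ _ ih => exact op1 .bang ih (.bang Γ)
  | ext A _ ih => exact op1 .ext ih (.ext A)
  | p A _ ih => exact op1 .p ih (.p A)
  | q A _ ih => exact op1 .q ih (.q A)
  | pair A γ a _ _ _ ih1 ih2 ih3 =>
    obtain ⟨c1, h1⟩ := ih1
    obtain ⟨c2, h2⟩ := ih2
    obtain ⟨c3, h3⟩ := ih3
    refine ⟨.op .pair c1 c2 c3, Code.eval_op g ?_⟩
    rw [h1, h2, h3]
    exact .pair A γ a
  | homDom γ _ ih => exact op1 .homDom ih (.homDom γ)
  | homCod γ _ ih => exact op1 .homCod ih (.homCod γ)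
  | tyCtx A _ ih => exact op1 .tyCtx ih (.tyCtx A)
  | tmTy a _ ih => exact op1 .tmTy ih (.tmTy a)

theorem Gen.small {P : CwF.{v, v, v, v}} {N : Type u} [Nonempty N] (g : N → Elt P) :
    Small.{u} {e : Elt P // Gen P g e} := by
  have h : Small.{u} (Set.range (Code.eval g)) := small_range _
  refine small_of_injective (β := Set.range (Code.eval g))
    (f := fun e => ⟨e.1, Gen.exists_code g e.2⟩) ?_
  intro a b hab
  exact Subtype.ext (congrArg (fun t => t.1) hab)

/-- Two strict morphisms agreeing on generators agree on everything generated. -/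
theorem Gen.agree {P : CwF.{u, u, u, u}} {D : CwF.{v, v, v, v}} {N : Type w} (g : N → Elt P)
    (F G : CwFHom P D) (hg : ∀ n, Elt.map F (g n) = Elt.map G (g n)) {e : Elt P}
    (h : Gen P g e) : Elt.map F e = Elt.map G e := by
  induction h with
  | gen n => exact hg n
  | one => simp only [Elt.map, F.obj_one, G.obj_one]
  | id Γ _ ih =>
    simp only [Elt.map, Elt.ctx.injEq, F.map_id, G.map_id] at ih ⊢
    rw [ih]
  | comp γ δ _ _ ih1 ih2 =>
    simp only [Elt.map, Elt.hom.injEq, F.map_comp, G.map_comp] at ih1 ih2 ⊢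
    exact ⟨ih2.1, ih1.2.1, CwF.comp_heq ih2.1 ih1.1 ih1.2.1 ih1.2.2 ih2.2.2⟩
  | subTy A γ _ _ ih1 ih2 =>
    simp only [Elt.map, Elt.hom.injEq, Elt.ty.injEq, F.mapTy_sub, G.mapTy_sub] at ih1 ih2 ⊢
    exact ⟨ih2.1, CwF.subTy_heq ih2.1 ih2.2.1 ih1.2 ih2.2.2⟩
  | subTm a γ _ _ ih1 ih2 =>
    simp only [Elt.map, Elt.hom.injEq, Elt.tm.injEq, F.mapTy_sub, G.mapTy_sub] at ih1 ih2 ⊢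
    exact ⟨ih2.1, CwF.subTy_heq ih2.1 ih2.2.1 ih1.2.1 ih2.2.2,
      (F.mapTm_sub a γ).trans ((CwF.subTm_heq ih2.1 ih2.2.1 ih1.2.1 ih1.2.2 ih2.2.2).trans
        (G.mapTm_sub a γ).symm)⟩
  | bang Γ _ ih =>
    simp only [Elt.map, Elt.ctx.injEq, Elt.hom.injEq] at ih ⊢
    refine ⟨ih, F.obj_one.trans G.obj_one.symm, (F.map_bang Γ).trans
      (HEq.trans ?_ (G.map_bang Γ).symm)⟩
    rw [ih]
  | ext A _ ih =>
    simp only [Elt.map, Elt.ctx.injEq, Elt.ty.injEq, F.obj_ext, G.obj_ext] at ih ⊢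
    exact CwF.ext_congr ih.1 ih.2
  | p A _ ih =>
    simp only [Elt.map, Elt.hom.injEq, Elt.ty.injEq, F.obj_ext, G.obj_ext] at ih ⊢
    exact ⟨CwF.ext_congr ih.1 ih.2, ih.1,
      (F.map_p A).trans ((CwF.p_heq ih.1 ih.2).trans (G.map_p A).symm)⟩
  | q A _ ih =>
    simp only [Elt.map, Elt.tm.injEq, Elt.ty.injEq, F.obj_ext, G.obj_ext] at ih ⊢
    have hp : HEq (F.map (P.p A)) (G.map (P.p A)) :=
      (F.map_p A).trans ((CwF.p_heq ih.1 ih.2).trans (G.map_p A).symm)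
    have he : F.obj (P.ext _ A) = G.obj (P.ext _ A) := by
      rw [F.obj_ext, G.obj_ext]; exact CwF.ext_congr ih.1 ih.2
    refine ⟨CwF.ext_congr ih.1 ih.2, ?_,
      (F.map_q A).trans ((CwF.q_heq ih.1 ih.2).trans (G.map_q A).symm)⟩
    rw [F.mapTy_sub, G.mapTy_sub]
    exact CwF.subTy_heq he ih.1 ih.2 hp
  | pair A γ a _ _ _ ih1 ih2 ih3 =>
    simp only [Elt.map, Elt.tm.injEq, Elt.ty.injEq, Elt.hom.injEq, F.obj_ext, G.obj_ext]
      at ih1 ih2 ih3 ⊢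
    refine ⟨ih2.1, CwF.ext_congr ih1.1 ih1.2, ?_⟩
    have cst : ∀ H : CwFHom P D, ∃ a' : D.Tm _ (D.subTy (H.mapTy A) (H.map γ)),
        HEq (H.mapTm a) a' := by
      intro H
      rw [← H.mapTy_sub]
      exact ⟨_, HEq.rfl⟩
    obtain ⟨a1, h1⟩ := cst F
    obtain ⟨a2, h2⟩ := cst G
    refine (F.map_pair A γ a a1 h1).trans (HEq.trans ?_ (G.map_pair A γ a a2 h2).symm)
    exact CwF.pair_heq ih2.1 ih1.1 ih1.2 ih2.2.2 (h1.symm.trans (ih3.2.2.trans h2))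
  | homDom γ _ ih =>
    simp only [Elt.map, Elt.ctx.injEq, Elt.hom.injEq] at ih ⊢
    exact ih.1
  | homCod γ _ ih =>
    simp only [Elt.map, Elt.ctx.injEq, Elt.hom.injEq] at ih ⊢
    exact ih.2.1
  | tyCtx A _ ih =>
    simp only [Elt.map, Elt.ctx.injEq, Elt.ty.injEq] at ih ⊢
    exact ih.1
  | tmTy a _ ih =>
    simp only [Elt.map, Elt.tm.injEq, Elt.ty.injEq] at ih ⊢
    exact ⟨ih.1, ih.2.1⟩

end gen

section product

theorem pi_heq_of_heq {J : Type v} {X : J → Type u} {f : (j : J) → X j} {Y : J → Type u}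
    (hXY : X = Y) {g : (j : J) → Y j} (h : HEq f g) (j : J) : HEq (f j) (g j) := by
  subst hXY
  cases h
  rfl

/-- The product of a (large) family of cwfs. -/
def CwF.prod {J : Type (u + 1)} (D : J → CwF.{u, u, u, u}) :
    CwF.{u + 1, u + 1, u + 1, u + 1} where
  Ctx := ∀ j, (D j).Ctx
  Hom Δ Γ := ∀ j, (D j).Hom (Δ j) (Γ j)
  id Γ j := (D j).id (Γ j)
  comp γ δ j := (D j).comp (γ j) (δ j)
  id_comp γ := funext fun j => (D j).id_comp (γ j)
  comp_id γ := funext fun j => (D j).comp_id (γ j)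
  comp_assoc γ δ ξ := funext fun j => (D j).comp_assoc (γ j) (δ j) (ξ j)
  Ty Γ := ∀ j, (D j).Ty (Γ j)
  Tm Γ A := ∀ j, (D j).Tm (Γ j) (A j)
  subTy A γ j := (D j).subTy (A j) (γ j)
  subTm a γ j := (D j).subTm (a j) (γ j)
  subTy_id A := funext fun j => (D j).subTy_id (A j)
  subTy_comp A γ δ := funext fun j => (D j).subTy_comp (A j) (γ j) (δ j)
  subTm_id a := Function.hfunext rfl fun j j' h => by
    cases h; exact (D j).subTm_id (a j)
  subTm_comp a γ δ := Function.hfunext rfl fun j j' h => by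
    cases h; exact (D j).subTm_comp (a j) (γ j) (δ j)
  one j := (D j).one
  bang Γ j := (D j).bang (Γ j)
  bang_unique γ := funext fun j => (D j).bang_unique (γ j)
  ext Γ A j := (D j).ext (Γ j) (A j)
  p A j := (D j).p (A j)
  q A j := (D j).q (A j)
  pair A γ a j := (D j).pair (A j) (γ j) (a j)
  p_pair A γ a := funext fun j => (D j).p_pair (A j) (γ j) (a j)
  q_pair A γ a := Function.hfunext rfl fun j j' h => by
    cases h; exact (D j).q_pair (A j) (γ j) (a j)
  pair_unique A γ a δ h1 h2 := funext fun j => by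
    subst h1
    refine (D j).pair_unique (A j) _ (a j) (δ j) rfl ?_
    refine pi_heq_of_heq (f := fun j => (D j).subTm ((D j).q (A j)) (δ j)) (g := a) ?_ h2 j
    funext j
    exact congrArg _ ((D j).subTy_comp _ _ _).symm

/-- Projections from the product. -/
def CwF.proj {J : Type (u + 1)} (D : J → CwF.{u, u, u, u}) (j : J) :
    CwFHom (CwF.prod D) (D j) where
  obj Γ := Γ j
  map γ := γ j
  map_id _ := rfl
  map_comp _ _ := rfl
  mapTy A := A j
  mapTm a := a j
  mapTy_sub _ _ := rfl
  mapTm_sub _ _ := HEq.rfl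
  obj_one := rfl
  obj_ext _ := rfl
  map_p _ := HEq.rfl
  map_q _ := HEq.rfl

end product

section sub

/-- Carriers and operations of a cwf (no laws) embedded in a cwf `P`. -/
structure Emb (P : CwF.{v, v, v, v}) where
  Ctx : Type u
  el : Ctx → P.Ctx
  el_inj : Function.Injective el
  Hom : Ctx → Ctx → Type u
  elH : {Δ Γ : Ctx} → Hom Δ Γ → P.Hom (el Δ) (el Γ)
  elH_inj : ∀ {Δ Γ : Ctx} {γ δ : Hom Δ Γ}, elH γ = elH δ → γ = δ
  Ty : Ctx → Type u
  elT : {Γ : Ctx} → Ty Γ → P.Ty (el Γ)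
  elT_inj : ∀ {Γ : Ctx} {A B : Ty Γ}, elT A = elT B → A = B
  Tm : (Γ : Ctx) → Ty Γ → Type u
  elM : {Γ : Ctx} → {A : Ty Γ} → Tm Γ A → P.Tm (el Γ) (elT A)
  elM_inj : ∀ {Γ : Ctx} {A : Ty Γ} {a b : Tm Γ A}, elM a = elM b → a = b
  id : (Γ : Ctx) → Hom Γ Γ
  el_id : ∀ Γ, elH (id Γ) = P.id (el Γ)
  comp : {Ξ Δ Γ : Ctx} → Hom Δ Γ → Hom Ξ Δ → Hom Ξ Γ
  el_comp : ∀ {Ξ Δ Γ : Ctx} (γ : Hom Δ Γ) (δ : Hom Ξ Δ),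
    elH (comp γ δ) = P.comp (elH γ) (elH δ)
  subTy : {Δ Γ : Ctx} → Ty Γ → Hom Δ Γ → Ty Δ
  el_subTy : ∀ {Δ Γ : Ctx} (A : Ty Γ) (γ : Hom Δ Γ), elT (subTy A γ) = P.subTy (elT A) (elH γ)
  subTm : {Δ Γ : Ctx} → {A : Ty Γ} → Tm Γ A → (γ : Hom Δ Γ) → Tm Δ (subTy A γ)
  el_subTm : ∀ {Δ Γ : Ctx} {A : Ty Γ} (a : Tm Γ A) (γ : Hom Δ Γ),
    HEq (elM (subTm a γ)) (P.subTm (elM a) (elH γ))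
  one : Ctx
  el_one : el one = P.one
  bang : (Γ : Ctx) → Hom Γ one
  ext : (Γ : Ctx) → Ty Γ → Ctx
  el_ext : ∀ {Γ : Ctx} (A : Ty Γ), el (ext Γ A) = P.ext (el Γ) (elT A)
  p : {Γ : Ctx} → (A : Ty Γ) → Hom (ext Γ A) Γ
  el_p : ∀ {Γ : Ctx} (A : Ty Γ), HEq (elH (p A)) (P.p (elT A))
  q : {Γ : Ctx} → (A : Ty Γ) → Tm (ext Γ A) (subTy A (p A))
  el_q : ∀ {Γ : Ctx} (A : Ty Γ), HEq (elM (q A)) (P.q (elT A))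
  pair : {Δ Γ : Ctx} → (A : Ty Γ) → (γ : Hom Δ Γ) → Tm Δ (subTy A γ) → Hom Δ (ext Γ A)
  el_pair : ∀ {Δ Γ : Ctx} (A : Ty Γ) (γ : Hom Δ Γ) (a : Tm Δ (subTy A γ))
    (a' : P.Tm (el Δ) (P.subTy (elT A) (elH γ))), HEq (elM a) a' →
    HEq (elH (pair A γ a)) (P.pair (elT A) (elH γ) a')

namespace Emb

variable {P : CwF.{v, v, v, v}} (E : Emb.{u, v} P)

theorem elM_hinj {Γ : E.Ctx} {A B : E.Ty Γ} {a : E.Tm Γ A} {b : E.Tm Γ B} (hAB : A = B)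
    (h : HEq (E.elM a) (E.elM b)) : HEq a b := by
  subst hAB
  exact heq_of_eq (E.elM_inj (eq_of_heq h))

theorem exists_cast {Δ Γ : E.Ctx} (A : E.Ty Γ) (γ : E.Hom Δ Γ) (a : E.Tm Δ (E.subTy A γ)) :
    ∃ a' : P.Tm (E.el Δ) (P.subTy (E.elT A) (E.elH γ)), HEq (E.elM a) a' := by
  rw [← E.el_subTy]
  exact ⟨_, HEq.rfl⟩

theorem subTy_id {Γ : E.Ctx} (A : E.Ty Γ) : E.subTy A (E.id Γ) = A :=
  E.elT_inj (by rw [E.el_subTy, E.el_id, P.subTy_id])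

theorem subTy_comp {Ξ Δ Γ : E.Ctx} (A : E.Ty Γ) (γ : E.Hom Δ Γ) (δ : E.Hom Ξ Δ) :
    E.subTy A (E.comp γ δ) = E.subTy (E.subTy A γ) δ :=
  E.elT_inj (by rw [E.el_subTy, E.el_comp, P.subTy_comp, E.el_subTy, E.el_subTy])

theorem p_pair {Δ Γ : E.Ctx} (A : E.Ty Γ) (γ : E.Hom Δ Γ) (a : E.Tm Δ (E.subTy A γ)) :
    E.comp (E.p A) (E.pair A γ a) = γ := by
  obtain ⟨a', ha⟩ := E.exists_cast A γ a
  apply E.elH_inj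
  rw [E.el_comp, ← P.p_pair (E.elT A) (E.elH γ) a']
  exact eq_of_heq (CwF.comp_heq rfl (E.el_ext A) rfl (E.el_p A) (E.el_pair A γ a a' ha))

theorem elT_subp {Γ : E.Ctx} (A : E.Ty Γ) :
    HEq (E.elT (E.subTy A (E.p A))) (P.subTy (E.elT A) (P.p (E.elT A))) :=
  (heq_of_eq (E.el_subTy _ _)).trans (CwF.subTy_heq (E.el_ext A) rfl HEq.rfl (E.el_p A))

theorem q_pair {Δ Γ : E.Ctx} (A : E.Ty Γ) (γ : E.Hom Δ Γ) (a : E.Tm Δ (E.subTy A γ)) :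
    HEq (E.subTm (E.q A) (E.pair A γ a)) a := by
  obtain ⟨a', ha⟩ := E.exists_cast A γ a
  refine E.elM_hinj (by rw [← E.subTy_comp, E.p_pair]) ?_
  refine (E.el_subTm _ _).trans (HEq.trans ?_ ha.symm)
  refine HEq.trans ?_ (P.q_pair (E.elT A) (E.elH γ) a')
  exact CwF.subTm_heq rfl (E.el_ext A) (E.elT_subp A) (E.el_q A) (E.el_pair A γ a a' ha)

theorem pair_unique {Δ Γ : E.Ctx} (A : E.Ty Γ) (γ : E.Hom Δ Γ) (a : E.Tm Δ (E.subTy A γ))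
    (δ : E.Hom Δ (E.ext Γ A)) (h1 : E.comp (E.p A) δ = γ) (h2 : HEq (E.subTm (E.q A) δ) a) :
    δ = E.pair A γ a := by
  obtain ⟨a', ha⟩ := E.exists_cast A γ a
  apply E.elH_inj
  refine eq_of_heq (HEq.trans ?_ (E.el_pair A γ a a' ha).symm)
  refine CwF.pair_unique_heq (E.elT A) (E.elH γ) a' (E.el_ext A) (E.elH (E.p A)) (E.el_p A)
    _ (E.elT_subp A) (E.elM (E.q A)) (E.el_q A) _ ?_ ?_
  · rw [← E.el_comp, h1]
  · refine (E.el_subTm _ _).symm.trans (HEq.trans ?_ ha)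
    have h3 : E.subTy (E.subTy A (E.p A)) δ = E.subTy A γ := by rw [← E.subTy_comp, h1]
    congr 1

theorem bang_unique {Γ : E.Ctx} (γ δ : E.Hom Γ E.one) : γ = δ := by
  apply E.elH_inj
  have key : ∀ (X : P.Ctx) (_ : X = P.one) (f g : P.Hom (E.el Γ) X), f = g := by
    intro X hX f g
    subst hX
    rw [P.bang_unique f, P.bang_unique g]
  exact key _ E.el_one _ _

/-- The cwf defined by an embedded structure. -/
def toCwF : CwF.{u, u, u, u} where
  Ctx := E.Ctx
  Hom := E.Hom
  id := E.id
  comp := E.comp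
  id_comp γ := E.elH_inj (by rw [E.el_comp, E.el_id, P.id_comp])
  comp_id γ := E.elH_inj (by rw [E.el_comp, E.el_id, P.comp_id])
  comp_assoc γ δ ξ := E.elH_inj (by simp only [E.el_comp, P.comp_assoc])
  Ty := E.Ty
  Tm := E.Tm
  subTy := E.subTy
  subTm := E.subTm
  subTy_id := E.subTy_id
  subTy_comp := E.subTy_comp
  subTm_id {Γ A} a := by
    refine E.elM_hinj (E.subTy_id A) ((E.el_subTm _ _).trans ?_)
    rw [E.el_id]
    exact P.subTm_id _
  subTm_comp {Ξ Δ Γ A} a γ δ := by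
    refine E.elM_hinj (E.subTy_comp A γ δ) ((E.el_subTm _ _).trans ?_)
    rw [E.el_comp]
    refine (P.subTm_comp _ _ _).trans (HEq.trans ?_ (E.el_subTm _ _).symm)
    exact CwF.subTm_heq rfl rfl (heq_of_eq (E.el_subTy A γ).symm) (E.el_subTm a γ).symm HEq.rfl
  one := E.one
  bang := E.bang
  bang_unique γ := E.bang_unique _ _
  ext := E.ext
  p := E.p
  q := E.q
  pair := E.pair
  p_pair := E.p_pair
  q_pair := E.q_pair
  pair_unique := E.pair_unique

/-- The inclusion. -/
def incl : CwFHom E.toCwF P where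
  obj := E.el
  map := E.elH
  map_id := E.el_id
  map_comp := E.el_comp
  mapTy := E.elT
  mapTm := E.elM
  mapTy_sub := E.el_subTy
  mapTm_sub := E.el_subTm
  obj_one := E.el_one
  obj_ext := E.el_ext
  map_p := E.el_p
  map_q := E.el_q

theorem incl_inj : Function.Injective (Elt.map E.incl) := by
  intro e e' h
  cases e with
  | ctx Γ =>
    cases e' <;> simp only [Elt.map, Elt.ctx.injEq, reduceCtorEq] at h
    rw [E.el_inj h]
  | hom Δ Γ γ =>
    cases e' <;> simp only [Elt.map, Elt.hom.injEq, reduceCtorEq] at h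
    obtain ⟨h1, h2, h3⟩ := h
    cases E.el_inj h1
    cases E.el_inj h2
    cases E.elH_inj (eq_of_heq h3)
    rfl
  | ty Γ A =>
    cases e' <;> simp only [Elt.map, Elt.ty.injEq, reduceCtorEq] at h
    obtain ⟨h1, h2⟩ := h
    cases E.el_inj h1
    cases E.elT_inj (eq_of_heq h2)
    rfl
  | tm Γ A a =>
    cases e' <;> simp only [Elt.map, Elt.tm.injEq, reduceCtorEq] at h
    obtain ⟨h1, h2, h3⟩ := h
    cases E.el_inj h1
    cases E.elT_inj (eq_of_heq h2)
    cases E.elM_inj (eq_of_heq h3)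
    rfl

end Emb

end sub

section shrink

/-- A small copy of a small subset. -/
def Shr {X : Type v} (Q : X → Prop) (h : Small.{u} {x // Q x}) : Type u := @Shrink _ h

namespace Shr

variable {X : Type v} {Q : X → Prop} {h : Small.{u} {x // Q x}}

/-- The underlying element. -/
noncomputable def val (s : Shr Q h) : X := ((@equivShrink _ h).symm s).1

theorem val_mem (s : Shr Q h) : Q s.val := ((@equivShrink _ h).symm s).2

theorem val_inj : Function.Injective (val : Shr Q h → X) := fun _ _ hst =>
  (@equivShrink _ h).symm.injective (Subtype.ext hst)

theorem exists_val {x : X} (hx : Q x) : ∃ s : Shr Q h, s.val = x :=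
  ⟨@equivShrink _ h ⟨x, hx⟩, by simp [val]⟩

/-- The small copy of an element. -/
noncomputable def mk {x : X} (hx : Q x) : Shr Q h := (exists_val hx).choose

theorem val_mk {x : X} (hx : Q x) : (mk hx : Shr Q h).val = x := (exists_val hx).choose_spec

end Shr

variable {P : CwF.{v, v, v, v}} {N : Type u} (g : N → Elt P)
  (hs : Small.{u} {e : Elt P // Gen P g e})

theorem small_ctx (hs : Small.{u} {e : Elt P // Gen P g e}) :
    Small.{u} {Γ : P.Ctx // Gen P g (.ctx Γ)} :=
  @small_of_injective _ _ hs (fun Γ => ⟨.ctx Γ.1, Γ.2⟩) (fun a b hab => by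
    simpa [Subtype.ext_iff] using hab)

theorem small_hom (hs : Small.{u} {e : Elt P // Gen P g e}) (Δ Γ : P.Ctx) :
    Small.{u} {γ : P.Hom Δ Γ // Gen P g (.hom _ _ γ)} :=
  @small_of_injective _ _ hs (fun γ => ⟨.hom _ _ γ.1, γ.2⟩) (fun a b hab => by
    simpa [Subtype.ext_iff] using hab)

theorem small_ty (hs : Small.{u} {e : Elt P // Gen P g e}) (Γ : P.Ctx) :
    Small.{u} {A : P.Ty Γ // Gen P g (.ty _ A)} :=
  @small_of_injective _ _ hs (fun γ => ⟨.ty _ γ.1, γ.2⟩) (fun a b hab => by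
    simpa [Subtype.ext_iff] using hab)

theorem small_tm (hs : Small.{u} {e : Elt P // Gen P g e}) (Γ : P.Ctx) (A : P.Ty Γ) :
    Small.{u} {a : P.Tm Γ A // Gen P g (.tm _ _ a)} :=
  @small_of_injective _ _ hs (fun γ => ⟨.tm _ _ γ.1, γ.2⟩) (fun a b hab => by
    simpa [Subtype.ext_iff] using hab)

/-- Small copy of the generated contexts. -/
abbrev GCtx : Type u := Shr (fun Γ : P.Ctx => Gen P g (.ctx Γ)) (small_ctx g hs)

/-- Small copy of the generated substitutions. -/
abbrev GHom (Δ Γ : GCtx g hs) : Type u :=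
  Shr (fun γ : P.Hom Δ.val Γ.val => Gen P g (.hom _ _ γ)) (small_hom g hs _ _)

/-- Small copy of the generated types. -/
abbrev GTy (Γ : GCtx g hs) : Type u :=
  Shr (fun A : P.Ty Γ.val => Gen P g (.ty _ A)) (small_ty g hs _)

/-- Small copy of the generated terms. -/
abbrev GTm (Γ : GCtx g hs) (A : GTy g hs Γ) : Type u :=
  Shr (fun a : P.Tm Γ.val A.val => Gen P g (.tm _ _ a)) (small_tm g hs _ _)

theorem exists_ghom {Δ Γ : GCtx g hs} {X Y : P.Ctx} (γ : P.Hom X Y) (hX : Δ.val = X)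
    (hY : Γ.val = Y) (hγ : Gen P g (.hom _ _ γ)) : ∃ s : GHom g hs Δ Γ, HEq s.val γ := by
  subst hX hY
  exact ⟨Shr.mk hγ, heq_of_eq (Shr.val_mk _)⟩

theorem exists_gty {Γ : GCtx g hs} {X : P.Ctx} (A : P.Ty X) (hX : Γ.val = X)
    (hA : Gen P g (.ty _ A)) : ∃ s : GTy g hs Γ, HEq s.val A := by
  subst hX
  exact ⟨Shr.mk hA, heq_of_eq (Shr.val_mk _)⟩

theorem exists_gtm {Γ : GCtx g hs} {B : GTy g hs Γ} {X : P.Ctx} {A : P.Ty X} (a : P.Tm X A)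
    (hX : Γ.val = X) (hA : HEq B.val A)
    (ha : Gen P g (.tm _ _ a)) : ∃ s : GTm g hs Γ B, HEq s.val a := by
  subst hX hA
  exact ⟨Shr.mk ha, heq_of_eq (Shr.val_mk _)⟩

/-- Extended context. -/
noncomputable def gext (Γ : GCtx g hs) (A : GTy g hs Γ) : GCtx g hs :=
  Shr.mk (Gen.ext A.val A.val_mem)

theorem gext_val (Γ : GCtx g hs) (A : GTy g hs Γ) :
    (gext g hs Γ A).val = P.ext Γ.val A.val := Shr.val_mk _

/-- Substitution in types. -/
noncomputable def gsubTy {Δ Γ : GCtx g hs} (A : GTy g hs Γ) (γ : GHom g hs Δ Γ) : GTy g hs Δ :=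
  Shr.mk (Gen.subTy A.val γ.val A.val_mem γ.val_mem)

theorem gsubTy_val {Δ Γ : GCtx g hs} (A : GTy g hs Γ) (γ : GHom g hs Δ Γ) :
    (gsubTy g hs A γ).val = P.subTy A.val γ.val := Shr.val_mk _

theorem exists_gp {Γ : GCtx g hs} (A : GTy g hs Γ) :
    ∃ s : GHom g hs (gext g hs Γ A) Γ, HEq s.val (P.p A.val) :=
  exists_ghom g hs _ (gext_val g hs Γ A) rfl (Gen.p A.val A.val_mem)

/-- The first projection. -/
noncomputable def gp {Γ : GCtx g hs} (A : GTy g hs Γ) : GHom g hs (gext g hs Γ A) Γ :=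
  (exists_gp g hs A).choose

theorem gp_val {Γ : GCtx g hs} (A : GTy g hs Γ) : HEq (gp g hs A).val (P.p A.val) :=
  (exists_gp g hs A).choose_spec

theorem exists_gq {Γ : GCtx g hs} (A : GTy g hs Γ) :
    ∃ s : GTm g hs (gext g hs Γ A) (gsubTy g hs A (gp g hs A)), HEq s.val (P.q A.val) :=
  exists_gtm g hs _ (gext_val g hs Γ A)
    ((heq_of_eq (gsubTy_val g hs _ _)).trans
      (CwF.subTy_heq (gext_val g hs Γ A) rfl HEq.rfl (gp_val g hs A)))
    (Gen.q A.val A.val_mem)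

theorem exists_gsubTm {Δ Γ : GCtx g hs} {A : GTy g hs Γ} (a : GTm g hs Γ A)
    (γ : GHom g hs Δ Γ) :
    ∃ s : GTm g hs Δ (gsubTy g hs A γ), HEq s.val (P.subTm a.val γ.val) :=
  exists_gtm g hs _ rfl (heq_of_eq (gsubTy_val g hs _ _))
    (Gen.subTm a.val γ.val a.val_mem γ.val_mem)

theorem exists_gpair {Δ Γ : GCtx g hs} (A : GTy g hs Γ) (γ : GHom g hs Δ Γ)
    (a : GTm g hs Δ (gsubTy g hs A γ)) :
    ∃ s : GHom g hs Δ (gext g hs Γ A), ∀ a' : P.Tm Δ.val (P.subTy A.val γ.val),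
      HEq a.val a' → HEq s.val (P.pair A.val γ.val a') := by
  have hc : ∃ a' : P.Tm Δ.val (P.subTy A.val γ.val), HEq a.val a' := by
    rw [← gsubTy_val]
    exact ⟨_, HEq.rfl⟩
  obtain ⟨a', ha⟩ := hc
  have key : ∀ (B C : P.Ty Δ.val) (_ : B = C) (b : P.Tm _ B) (c : P.Tm _ C), HEq b c →
      Gen P g (.tm _ _ b) → Gen P g (.tm _ _ c) := by
    intro B C h b c h'
    subst h h'
    exact fun h => h
  have ha' : Gen P g (.tm _ _ a') := key _ _ (gsubTy_val g hs A γ) _ _ ha a.val_mem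
  obtain ⟨s, hs'⟩ := exists_ghom g hs (P.pair A.val γ.val a') rfl (gext_val g hs Γ A)
    (Gen.pair A.val γ.val a' A.val_mem γ.val_mem ha')
  refine ⟨s, fun a'' h'' => ?_⟩
  have : a'' = a' := eq_of_heq (h''.symm.trans ha)
  rw [this]
  exact hs'

theorem exists_gbang (Γ : GCtx g hs) :
    ∃ s : GHom g hs Γ (Shr.mk Gen.one), HEq s.val (P.bang Γ.val) :=
  exists_ghom g hs _ rfl (Shr.val_mk _) (Gen.bang _ Γ.val_mem)

/-- The generated sub-cwf, as an embedded structure. -/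
noncomputable def genEmb : Emb.{u, v} P where
  Ctx := GCtx g hs
  el := Shr.val
  el_inj := Shr.val_inj
  Hom := GHom g hs
  elH := Shr.val
  elH_inj h := Shr.val_inj h
  Ty := GTy g hs
  elT := Shr.val
  elT_inj h := Shr.val_inj h
  Tm := GTm g hs
  elM := Shr.val
  elM_inj h := Shr.val_inj h
  id Γ := Shr.mk (Gen.id Γ.val Γ.val_mem)
  el_id Γ := Shr.val_mk _
  comp γ δ := Shr.mk (Gen.comp γ.val δ.val γ.val_mem δ.val_mem)
  el_comp _ _ := Shr.val_mk _
  subTy := gsubTy g hs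
  el_subTy := gsubTy_val g hs
  subTm a γ := (exists_gsubTm g hs a γ).choose
  el_subTm a γ := (exists_gsubTm g hs a γ).choose_spec
  one := Shr.mk Gen.one
  el_one := Shr.val_mk _
  bang Γ := (exists_gbang g hs Γ).choose
  ext := gext g hs
  el_ext := gext_val g hs _
  p := gp g hs
  el_p := gp_val g hs
  q A := (exists_gq g hs A).choose
  el_q A := (exists_gq g hs A).choose_spec
  pair A γ a := (exists_gpair g hs A γ a).choose
  el_pair A γ a := (exists_gpair g hs A γ a).choose_spec

theorem exists_sub (hs : Small.{u} {e : Elt P // Gen P g e}) :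
    ∃ (K : CwF.{u, u, u, u}) (ι : CwFHom K P), Function.Injective (Elt.map ι) ∧
      (∀ x, Gen P g (Elt.map ι x)) ∧ ∀ n, ∃ x, Elt.map ι x = g n := by
  refine ⟨(genEmb g hs).toCwF, (genEmb g hs).incl, (genEmb g hs).incl_inj, ?_, ?_⟩
  · intro x
    cases x with
    | ctx Γ => exact Shr.val_mem Γ
    | hom Δ Γ γ => exact Shr.val_mem γ
    | ty Γ A => exact Shr.val_mem A
    | tm Γ A a => exact Shr.val_mem a
  · intro n
    suffices h : ∀ e, Gen P g e → ∃ x, Elt.map (genEmb g hs).incl x = e from h _ (Gen.gen n)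
    intro e he
    have hctx : ∀ Γ, Gen P g (.ctx Γ) → ∃ Γ' : GCtx g hs, Γ'.val = Γ :=
      fun Γ h => Shr.exists_val h
    cases e with
    | ctx Γ =>
      obtain ⟨Γ', rfl⟩ := hctx Γ he
      exact ⟨.ctx Γ', rfl⟩
    | hom Δ Γ γ =>
      obtain ⟨Γ', rfl⟩ := hctx Γ (Gen.homCod γ he)
      obtain ⟨Δ', rfl⟩ := hctx Δ (Gen.homDom γ he)
      obtain ⟨s, h⟩ := exists_ghom g hs γ rfl rfl he
      cases h
      exact ⟨.hom Δ' Γ' s, rfl⟩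
    | ty Γ A =>
      obtain ⟨Γ', rfl⟩ := hctx Γ (Gen.tyCtx A he)
      obtain ⟨s, h⟩ := exists_gty g hs A rfl he
      cases h
      exact ⟨.ty Γ' s, rfl⟩
    | tm Γ A a =>
      obtain ⟨Γ', rfl⟩ := hctx Γ (Gen.tyCtx A (Gen.tmTy a he))
      obtain ⟨s, h⟩ := exists_gty g hs A rfl (Gen.tmTy a he)
      cases h
      obtain ⟨t, h⟩ := exists_gtm g hs (B := s) a rfl HEq.rfl he
      cases h
      exact ⟨.tm Γ' s t, rfl⟩

end shrink

section lifting

/-- The lifting property: structure descends to small jointly embedded sub-cwfs containing a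
small set of (uniform) generators. -/
def SigCat.Lifts (S : SigCat.{u}) : Prop :=
  ∀ (J : Type (u + 1)) (C : J → S.Obj), ∃ (N : Type u) (_ : Nonempty N)
    (g : N → Elt (CwF.prod fun j => S.cwf (C j))),
    (∀ n j j' (F : CwFHom (S.cwf (C j)) (S.cwf (C j'))), S.Mor (C j) (C j') F →
      Elt.map F (Elt.map (CwF.proj (fun j => S.cwf (C j)) j) (g n)) =
        Elt.map (CwF.proj (fun j => S.cwf (C j)) j') (g n)) ∧
    ∀ (K : CwF.{u, u, u, u}) (ι : CwFHom K (CwF.prod fun j => S.cwf (C j))),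
      Function.Injective (Elt.map ι) → (∀ n, ∃ x, Elt.map ι x = g n) →
      ∃ (L : S.Obj) (h : K = S.cwf L),
        ∀ j, S.Mor L (C j) (h ▸ ι.trans (CwF.proj (fun j => S.cwf (C j)) j))

theorem SigCat.lifts_empty : SigCat.Lifts SigCat.empty.{u} := by
  intro J C
  refine ⟨PUnit, inferInstance, fun _ => .ctx (CwF.one _), ?_, ?_⟩
  · intro n j j' F _
    exact congrArg Elt.ctx F.obj_one
  · intro K ι _ _
    exact ⟨K, rfl, fun _ => trivial⟩

/-- A context of a lifted object lying over a uniform family is the uniform one. -/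
theorem UnifCtx.eq_of_over {S : SigCat.{u}} (Γ : UnifCtx S) {J : Type (u + 1)} {C : J → S.Obj}
    {L : S.Obj} {ι : CwFHom (S.cwf L) (CwF.prod fun j => S.cwf (C j))}
    (hι : Function.Injective (Elt.map ι))
    (hm : ∀ j, S.Mor L (C j) (ι.trans (CwF.proj (fun j => S.cwf (C j)) j)))
    {X : (S.cwf L).Ctx} (hX : ι.obj X = fun j => Γ.fam (C j)) : X = Γ.fam L := by
  have h : Elt.map ι (.ctx X) = Elt.map ι (.ctx (Γ.fam L)) := by
    refine congrArg Elt.ctx ?_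
    rw [hX]
    funext j
    exact (Γ.uniform _ (hm j)).symm
  exact Elt.ctx.inj (hι h)

theorem UnifTy.eq_of_over {S : SigCat.{u}} {Γ : UnifCtx S} (A : UnifTy S Γ) {J : Type (u + 1)}
    {C : J → S.Obj}
    {L : S.Obj} {ι : CwFHom (S.cwf L) (CwF.prod fun j => S.cwf (C j))}
    (hι : Function.Injective (Elt.map ι))
    (hm : ∀ j, S.Mor L (C j) (ι.trans (CwF.proj (fun j => S.cwf (C j)) j)))
    {X : (S.cwf L).Ty (Γ.fam L)} (hX : ∀ j, HEq (ι.mapTy X j) (A.fam (C j))) : X = A.fam L := by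
  have h : Elt.map ι (.ty _ X) = Elt.map ι (.ty _ (A.fam L)) := by
    refine congrArg (Elt.ty _) ?_
    funext j
    exact eq_of_heq ((hX j).trans (A.uniform _ (hm j)).symm)
  exact eq_of_heq (Elt.ty.inj (hι h)).2

theorem prod_ty_heq {J : Type (u + 1)} {D : J → CwF.{u, u, u, u}} {Γ Δ : (CwF.prod D).Ctx}
    (h : Γ = Δ) {A : (CwF.prod D).Ty Γ} {B : (CwF.prod D).Ty Δ} (hAB : HEq A B) (j : J) :
    HEq (A j) (B j) := by
  subst h hAB; rfl

theorem prod_tm_heq {J : Type (u + 1)} {D : J → CwF.{u, u, u, u}} {Γ Δ : (CwF.prod D).Ctx}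
    (h : Γ = Δ) {A : (CwF.prod D).Ty Γ} {B : (CwF.prod D).Ty Δ} (hAB : HEq A B)
    {a : (CwF.prod D).Tm Γ A} {b : (CwF.prod D).Tm Δ B} (hab : HEq a b) (j : J) :
    HEq (a j) (b j) := by
  subst h hAB hab; rfl

theorem SigCat.lifts_addSort (S : SigCat.{u}) (Γ : UnifCtx S) (hS : S.Lifts) :
    (S.addSort Γ).Lifts := by
  intro J C
  obtain ⟨N, _, g, hg, hl⟩ := hS J (fun j => (C j).1)
  refine ⟨Option N, inferInstance, fun o => o.elim
    (Elt.ty (C := CwF.prod fun j => S.cwf (C j).1)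
      (fun j => Γ.fam (C j).1) (fun j => (C j).2)) g, ?_, ?_⟩
  · intro n j j' F hF
    cases n with
    | none => exact (Elt.ty.injEq ..).mpr ⟨Γ.uniform F hF.1, hF.2⟩
    | some n => exact hg n j j' F hF.1
  · intro K ι hι hx
    obtain ⟨L, rfl, hm⟩ := hl K ι hι (fun n => hx (some n))
    obtain ⟨x, hx⟩ := hx none
    cases x with
    | ty X T =>
      obtain ⟨h1, h2⟩ := Elt.ty.inj hx
      obtain rfl := Γ.eq_of_over hι hm h1
      exact ⟨⟨L, T⟩, rfl, fun j => ⟨hm j, prod_ty_heq h1 h2 j⟩⟩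
    | ctx _ => exact nomatch hx
    | hom _ _ _ => exact nomatch hx
    | tm _ _ _ => exact nomatch hx

theorem SigCat.lifts_addOp (S : SigCat.{u}) (Γ : UnifCtx S) (A : UnifTy S Γ) (hS : S.Lifts) :
    (S.addOp Γ A).Lifts := by
  intro J C
  obtain ⟨N, _, g, hg, hl⟩ := hS J (fun j => (C j).1)
  refine ⟨Option N, inferInstance, fun o => o.elim
    (Elt.tm (C := CwF.prod fun j => S.cwf (C j).1)
      (fun j => Γ.fam (C j).1) (fun j => A.fam (C j).1) (fun j => (C j).2)) g, ?_, ?_⟩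
  · intro n j j' F hF
    cases n with
    | none => exact (Elt.tm.injEq ..).mpr ⟨Γ.uniform F hF.1, A.uniform F hF.1, hF.2⟩
    | some n => exact hg n j j' F hF.1
  · intro K ι hι hx
    obtain ⟨L, rfl, hm⟩ := hl K ι hι (fun n => hx (some n))
    obtain ⟨x, hx⟩ := hx none
    cases x with
    | tm X T t =>
      obtain ⟨h1, h2, h3⟩ := Elt.tm.inj hx
      obtain rfl := Γ.eq_of_over hι hm h1
      obtain rfl := A.eq_of_over hι hm (prod_ty_heq h1 h2)
      exact ⟨⟨L, t⟩, rfl, fun j => ⟨hm j, prod_tm_heq h1 h2 h3 j⟩⟩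
    | ctx _ => exact nomatch hx
    | hom _ _ _ => exact nomatch hx
    | ty _ _ => exact nomatch hx

theorem SigCat.lifts_addEq (S : SigCat.{u}) (Γ : UnifCtx S) (A : UnifTy S Γ)
    (a a' : UnifTm S Γ A) (hS : S.Lifts) : (S.addEq Γ A a a').Lifts := by
  intro J C
  obtain ⟨N, hN, g, hg, hl⟩ := hS J (fun j => (C j).1)
  refine ⟨N, hN, g, fun n j j' F hF => hg n j j' F hF, ?_⟩
  intro K ι hι hx
  obtain ⟨L, rfl, hm⟩ := hl K ι hι hx
  have h : Elt.map ι (.tm _ _ (a.fam L)) = Elt.map ι (.tm _ _ (a'.fam L)) := by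
    refine congrArg (Elt.tm _ _) ?_
    funext j
    have h1 := a.uniform _ (hm j)
    have h2 := a'.uniform _ (hm j)
    rw [(C j).2] at h1
    exact eq_of_heq (h1.trans h2.symm)
  exact ⟨⟨L, eq_of_heq (Elt.tm.inj (hι h)).2.2⟩, rfl, hm⟩

theorem SigCat.Valid.lifts {S : SigCat.{u}} (hS : S.Valid) : S.Lifts := by
  induction hS with
  | empty => exact SigCat.lifts_empty
  | addSort S Γ _ ih => exact S.lifts_addSort Γ ih
  | addOp S Γ A _ ih => exact S.lifts_addOp Γ A ih
  | addEq S Γ A a a' _ ih => exact S.lifts_addEq Γ A a a' ih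

/-- Elements of a product cwf coming from an embedded cwf are determined by projections. -/
theorem Elt.eq_of_proj {J : Type (u + 1)} {D : J → CwF.{u, u, u, u}} [hJ : Nonempty J]
    {x y : Elt (CwF.prod D)}
    (h : ∀ j, Elt.map (CwF.proj D j) x = Elt.map (CwF.proj D j) y) : x = y := by
  obtain ⟨j₀⟩ := hJ
  cases x with
  | ctx Γ =>
    cases y with
    | ctx Γ' => exact congrArg Elt.ctx (funext fun j => Elt.ctx.inj (h j))
    | _ => exact nomatch h j₀
  | hom Δ Γ γ =>
    cases y with
    | hom Δ' Γ' γ' =>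
      obtain rfl : Δ = Δ' := funext fun j => (Elt.hom.inj (h j)).1
      obtain rfl : Γ = Γ' := funext fun j => (Elt.hom.inj (h j)).2.1
      exact congrArg (Elt.hom _ _) (funext fun j => eq_of_heq (Elt.hom.inj (h j)).2.2)
    | _ => exact nomatch h j₀
  | ty Γ A =>
    cases y with
    | ty Γ' A' =>
      obtain rfl : Γ = Γ' := funext fun j => (Elt.ty.inj (h j)).1
      exact congrArg (Elt.ty _) (funext fun j => eq_of_heq (Elt.ty.inj (h j)).2)
    | _ => exact nomatch h j₀
  | tm Γ A a =>
    cases y with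
    | tm Γ' A' a' =>
      obtain rfl : Γ = Γ' := funext fun j => (Elt.tm.inj (h j)).1
      obtain rfl : A = A' := funext fun j => eq_of_heq (Elt.tm.inj (h j)).2.1
      exact congrArg (Elt.tm _ _) (funext fun j => eq_of_heq (Elt.tm.inj (h j)).2.2)
    | _ => exact nomatch h j₀

theorem SigCat.Lifts.exists_initial {S : SigCat.{u}} (hS : S.Lifts) :
    ∃ I : S.Obj, S.IsInitial I := by
  obtain ⟨N, _, g, hg, hl⟩ := hS S.Obj (fun C => C)
  obtain ⟨K, ι, hι, hgen, hr⟩ := exists_sub g (Gen.small g)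
  obtain ⟨L, rfl, hm⟩ := hl K ι hι hr
  refine ⟨L, fun C => ⟨_, hm C, ?_⟩⟩
  -- all elements of `L` are uniform
  have hu : ∀ (x : Elt (S.cwf L)) (j j' : S.Obj) (F : CwFHom (S.cwf j) (S.cwf j')),
      S.Mor j j' F → Elt.map F (Elt.map (CwF.proj (fun j => S.cwf j) j) (Elt.map ι x)) =
        Elt.map (CwF.proj (fun j => S.cwf j) j') (Elt.map ι x) := by
    intro x j j' F hF
    rw [← Elt.map_trans]
    refine Gen.agree g _ _ (fun n => ?_) (hgen x)
    rw [Elt.map_trans]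
    exact hg n j j' F hF
  have hid : ∀ x : Elt (S.cwf L),
      Elt.map (CwF.proj (fun j => S.cwf j) L) (Elt.map ι x) = x := by
    intro x
    apply hι
    haveI : Nonempty S.Obj := ⟨L⟩
    refine Elt.eq_of_proj fun j => ?_
    have := hu x L j _ (hm j)
    rw [Elt.map_trans] at this
    exact this
  intro F hF
  refine CwFHom.ext_elt _ _ fun x => ?_
  have := hu x L C F hF
  rw [hid] at this
  rw [this]
  exact (Elt.map_trans _ _ _).symm

end lifting

/-- Operator-extension step of the initiality theorem: if `CwF_Σ` has an
initial object then so does `CwF_{Σ'}` for `Σ' = (Σ,(Γ,A,f))`, the extension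
of `Σ` by a new operator symbol relative to a uniform family of contexts `Γ`
and a uniform family of types `A`. -/
theorem addOp_has_initial (S : SigCat.{u}) (hS : S.Valid)
    (hI : ∃ I : S.Obj, S.IsInitial I) (Γ : UnifCtx S) (A : UnifTy S Γ) :
    ∃ I' : (S.addOp Γ A).Obj, (S.addOp Γ A).IsInitial I' := by
  exact (S.lifts_addOp Γ A hS.lifts).exists_initial
end

section
/- (Equation-extension step of the initiality theorem.) Let Σ be a valid signature such that CwF_Σ has an initial object, let Γ be a uniform family of contexts over CwF_Σ, let A be a uniform family of types over Γ, and let a, a' be uniform families of terms of type A. Then the full subcategory CwF_{Σ'} of CwF_Σ on the objects C with a_C = a'_C has an initial object. -/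
universe u v w x u' v' w' x'

universe u₂ v₂ w₂ x₂

namespace CwF

theorem subTy_heq_s12 (P : CwF.{u, v, w, x}) {Δ Γ Δ' Γ' : P.Ctx} {A : P.Ty Γ} {A' : P.Ty Γ'}
    {γ : P.Hom Δ Γ} {γ' : P.Hom Δ' Γ'} (hΔ : Δ = Δ') (hΓ : Γ = Γ') (hA : HEq A A')
    (hγ : HEq γ γ') : HEq (P.subTy A γ) (P.subTy A' γ') := by
  subst hΔ; subst hΓ; cases hA; cases hγ; rfl

theorem subTm_heq_s12 (P : CwF.{u, v, w, x}) {Δ Γ Δ' Γ' : P.Ctx} {A : P.Ty Γ} {A' : P.Ty Γ'}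
    {a : P.Tm Γ A} {a' : P.Tm Γ' A'}
    {γ : P.Hom Δ Γ} {γ' : P.Hom Δ' Γ'} (hΔ : Δ = Δ') (hΓ : Γ = Γ') (hA : HEq A A')
    (ha : HEq a a') (hγ : HEq γ γ') : HEq (P.subTm a γ) (P.subTm a' γ') := by
  subst hΔ; subst hΓ; cases hA; cases hγ; cases ha; rfl

theorem comp_heq_s12 (P : CwF.{u, v, w, x}) {Ξ Δ Γ Ξ' Δ' Γ' : P.Ctx}
    {γ : P.Hom Δ Γ} {γ' : P.Hom Δ' Γ'} {δ : P.Hom Ξ Δ} {δ' : P.Hom Ξ' Δ'}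
    (hΞ : Ξ = Ξ') (hΔ : Δ = Δ') (hΓ : Γ = Γ')
    (hγ : HEq γ γ') (hδ : HEq δ δ') : HEq (P.comp γ δ) (P.comp γ' δ') := by
  subst hΞ; subst hΔ; subst hΓ; cases hγ; cases hδ; rfl

theorem ext_heq (P : CwF.{u, v, w, x}) {Γ Γ' : P.Ctx} {A : P.Ty Γ} {A' : P.Ty Γ'}
    (hΓ : Γ = Γ') (hA : HEq A A') : P.ext Γ A = P.ext Γ' A' := by
  subst hΓ; cases hA; rfl

theorem p_heq_s12 (P : CwF.{u, v, w, x}) {Γ Γ' : P.Ctx} {A : P.Ty Γ} {A' : P.Ty Γ'}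
    (hΓ : Γ = Γ') (hA : HEq A A') : HEq (P.p A) (P.p A') := by
  subst hΓ; cases hA; rfl

theorem q_heq_s12 (P : CwF.{u, v, w, x}) {Γ Γ' : P.Ctx} {A : P.Ty Γ} {A' : P.Ty Γ'}
    (hΓ : Γ = Γ') (hA : HEq A A') : HEq (P.q A) (P.q A') := by
  subst hΓ; cases hA; rfl

theorem pair_heq_s12 (P : CwF.{u, v, w, x}) {Δ Γ Δ' Γ' : P.Ctx} {A : P.Ty Γ} {A' : P.Ty Γ'}
    {γ : P.Hom Δ Γ} {γ' : P.Hom Δ' Γ'}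
    {a : P.Tm Δ (P.subTy A γ)} {a' : P.Tm Δ' (P.subTy A' γ')}
    (hΔ : Δ = Δ') (hΓ : Γ = Γ') (hA : HEq A A')
    (hγ : HEq γ γ') (ha : HEq a a') : HEq (P.pair A γ a) (P.pair A' γ' a') := by
  subst hΔ; subst hΓ; cases hA; cases hγ; cases ha; rfl

theorem pair_unique_heq_s12 (P : CwF.{u, v, w, x}) {Δ Γ Ξ : P.Ctx} (A : P.Ty Γ) (γ : P.Hom Δ Γ)
    (a : P.Tm Δ (P.subTy A γ)) (hΞ : Ξ = P.ext Γ A) (δ : P.Hom Δ Ξ) (p' : P.Hom Ξ Γ)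
    (hp : HEq p' (P.p A)) (q' : P.Tm Ξ (P.subTy A p')) (hq : HEq q' (P.q A))
    (h1 : P.comp p' δ = γ) (h2 : HEq (P.subTm q' δ) a) : HEq δ (P.pair A γ a) := by
  subst hΞ; cases hp; cases hq
  exact heq_of_eq (P.pair_unique A γ a δ h1 h2)

/-- The elements of a cwf, of all four sorts. -/
inductive El (P : CwF.{u, v, w, x}) : Type (max u v w x)
  | ctx (Γ : P.Ctx) : El P
  | hom {Δ Γ : P.Ctx} (f : P.Hom Δ Γ) : El P
  | ty {Γ : P.Ctx} (A : P.Ty Γ) : El P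
  | tm {Γ : P.Ctx} {A : P.Ty Γ} (a : P.Tm Γ A) : El P

theorem El.hom_eq {P : CwF.{u, v, w, x}} {Δ Γ Δ' Γ' : P.Ctx} {f : P.Hom Δ Γ} {f' : P.Hom Δ' Γ'}
    (h1 : Δ = Δ') (h2 : Γ = Γ') (h : HEq f f') : El.hom f = El.hom f' := by
  subst h1; subst h2; cases h; rfl

theorem El.ty_eq {P : CwF.{u, v, w, x}} {Γ Γ' : P.Ctx} {A : P.Ty Γ} {A' : P.Ty Γ'}
    (h2 : Γ = Γ') (h : HEq A A') : El.ty A = El.ty A' := by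
  subst h2; cases h; rfl

theorem El.tm_eq {P : CwF.{u, v, w, x}} {Γ Γ' : P.Ctx} {A : P.Ty Γ} {A' : P.Ty Γ'}
    {a : P.Tm Γ A} {a' : P.Tm Γ' A'}
    (h2 : Γ = Γ') (h : HEq A A') (h' : HEq a a') : El.tm a = El.tm a' := by
  subst h2; cases h; cases h'; rfl

/-- The generating operations of a cwf, as a partial ternary operation on elements. -/
inductive Step (P : CwF.{u, v, w, x}) : ℕ → El P → El P → El P → El P → Prop
  | id (Γ : P.Ctx) : Step P 0 (.ctx Γ) (.ctx Γ) (.ctx Γ) (.hom (P.id Γ))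
  | comp {Ξ Δ Γ : P.Ctx} (γ : P.Hom Δ Γ) (δ : P.Hom Ξ Δ) :
      Step P 1 (.hom γ) (.hom δ) (.hom δ) (.hom (P.comp γ δ))
  | subTy {Δ Γ : P.Ctx} (A : P.Ty Γ) (γ : P.Hom Δ Γ) :
      Step P 2 (.ty A) (.hom γ) (.hom γ) (.ty (P.subTy A γ))
  | subTm {Δ Γ : P.Ctx} {A : P.Ty Γ} (a : P.Tm Γ A) (γ : P.Hom Δ Γ) :
      Step P 3 (.tm a) (.hom γ) (.hom γ) (.tm (P.subTm a γ))
  | bang (Γ : P.Ctx) : Step P 4 (.ctx Γ) (.ctx Γ) (.ctx Γ) (.hom (P.bang Γ))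
  | ext {Γ : P.Ctx} (A : P.Ty Γ) : Step P 5 (.ty A) (.ty A) (.ty A) (.ctx (P.ext Γ A))
  | p {Γ : P.Ctx} (A : P.Ty Γ) : Step P 6 (.ty A) (.ty A) (.ty A) (.hom (P.p A))
  | q {Γ : P.Ctx} (A : P.Ty Γ) : Step P 7 (.ty A) (.ty A) (.ty A) (.tm (P.q A))
  | pair {Δ Γ : P.Ctx} (A : P.Ty Γ) (γ : P.Hom Δ Γ) (a : P.Tm Δ (P.subTy A γ)) :
      Step P 8 (.ty A) (.hom γ) (.tm a) (.hom (P.pair A γ a))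

theorem Step.functional {P : CwF.{u, v, w, x}} {k : ℕ} {e₁ e₂ e₃ e e' : El P}
    (h : Step P k e₁ e₂ e₃ e) (h' : Step P k e₁ e₂ e₃ e') : e = e' := by
  cases h <;> cases h' <;> rfl

/-- Closure of a family of elements under the cwf operations. -/
inductive Clo (P : CwF.{u, v, w, x}) {B : Type u'} (b : B → El P) : El P → Prop
  | base (i : B) : Clo P b (b i)
  | step {k : ℕ} {e₁ e₂ e₃ e : El P} : Step P k e₁ e₂ e₃ e → Clo P b e₁ → Clo P b e₂ →
      Clo P b e₃ → Clo P b e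

/-- Codes for elements of the closure. -/
inductive Raw (B : Type u') : Type u'
  | base (i : B) : Raw B
  | node (k : ℕ) (t₁ t₂ t₃ : Raw B) : Raw B

/-- Partial evaluation of codes. -/
def Raw.ev (P : CwF.{u, v, w, x}) {B : Type u'} (b : B → El P) : Raw B → El P → Prop
  | .base i, e => e = b i
  | .node k t₁ t₂ t₃, e => ∃ e₁ e₂ e₃, Raw.ev P b t₁ e₁ ∧ Raw.ev P b t₂ e₂ ∧ Raw.ev P b t₃ e₃ ∧
      Step P k e₁ e₂ e₃ e

theorem Raw.ev_functional (P : CwF.{u, v, w, x}) {B : Type u'} (b : B → El P) (t : Raw B) :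
    ∀ e e', Raw.ev P b t e → Raw.ev P b t e' → e = e' := by
  induction t with
  | base i => intro e e' h h'; exact h.trans h'.symm
  | node k t₁ t₂ t₃ h₁ h₂ h₃ =>
    rintro e e' ⟨a₁, a₂, a₃, ha₁, ha₂, ha₃, ha⟩ ⟨c₁, c₂, c₃, hc₁, hc₂, hc₃, hc⟩
    obtain rfl := h₁ _ _ ha₁ hc₁
    obtain rfl := h₂ _ _ ha₂ hc₂
    obtain rfl := h₃ _ _ ha₃ hc₃
    exact ha.functional hc

theorem Clo.exists_raw {P : CwF.{u, v, w, x}} {B : Type u'} {b : B → El P} {e : El P}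
    (h : Clo P b e) : ∃ t : Raw B, Raw.ev P b t e := by
  induction h with
  | base i => exact ⟨.base i, rfl⟩
  | step hs _ _ _ h₁ h₂ h₃ =>
    obtain ⟨t₁, h₁⟩ := h₁
    obtain ⟨t₂, h₂⟩ := h₂
    obtain ⟨t₃, h₃⟩ := h₃
    exact ⟨.node _ t₁ t₂ t₃, _, _, _, h₁, h₂, h₃, hs⟩

theorem Clo.small {P : CwF.{u, v, w, x}} {B : Type u'} (b : B → El P) :
    Small.{u'} {e : El P // Clo P b e} := by
  choose f hf using fun e : {e : El P // Clo P b e} => e.2.exists_raw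
  refine small_of_injective (β := Raw B) (f := f) ?_
  intro e e' h
  have h1 := hf e
  rw [h] at h1
  exact Subtype.ext (Raw.ev_functional P b _ _ _ h1 (hf e'))

/-- Product of a family of cwfs. -/
def prod_s12 {J : Type u'} (D : J → CwF.{u, v, w, x}) :
    CwF.{max u' u, max u' v, max u' w, max u' x} where
  Ctx := ∀ j, (D j).Ctx
  Hom Δ Γ := ∀ j, (D j).Hom (Δ j) (Γ j)
  id Γ := fun j => (D j).id (Γ j)
  comp γ δ := fun j => (D j).comp (γ j) (δ j)
  id_comp γ := funext fun j => (D j).id_comp (γ j)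
  comp_id γ := funext fun j => (D j).comp_id (γ j)
  comp_assoc γ δ ξ := funext fun j => (D j).comp_assoc (γ j) (δ j) (ξ j)
  Ty Γ := ∀ j, (D j).Ty (Γ j)
  Tm Γ A := ∀ j, (D j).Tm (Γ j) (A j)
  subTy A γ := fun j => (D j).subTy (A j) (γ j)
  subTm a γ := fun j => (D j).subTm (a j) (γ j)
  subTy_id A := funext fun j => (D j).subTy_id (A j)
  subTy_comp A γ δ := funext fun j => (D j).subTy_comp (A j) (γ j) (δ j)
  subTm_id a := Function.hfunext rfl fun j j' h => by
    cases h; exact (D j).subTm_id (a j)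
  subTm_comp a γ δ := Function.hfunext rfl fun j j' h => by
    cases h; exact (D j).subTm_comp (a j) (γ j) (δ j)
  one := fun j => (D j).one
  bang Γ := fun j => (D j).bang (Γ j)
  bang_unique γ := funext fun j => (D j).bang_unique (γ j)
  ext Γ A := fun j => (D j).ext (Γ j) (A j)
  p A := fun j => (D j).p (A j)
  q A := fun j => (D j).q (A j)
  pair A γ a := fun j => (D j).pair (A j) (γ j) (a j)
  p_pair A γ a := funext fun j => (D j).p_pair (A j) (γ j) (a j)
  q_pair A γ a := Function.hfunext rfl fun j j' h => by
    cases h; exact (D j).q_pair (A j) (γ j) (a j)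
  pair_unique {Δ Γ} A γ a δ h1 h2 := by
    have key : ∀ (B B' : ∀ j, (D j).Ty (Δ j)) (_ : B = B') (c : ∀ j, (D j).Tm (Δ j) (B j))
        (c' : ∀ j, (D j).Tm (Δ j) (B' j)), HEq c c' → ∀ j, HEq (c j) (c' j) := by
      intro B B' hB c c' hc j
      subst hB; cases hc; rfl
    funext j
    refine (D j).pair_unique (A j) (γ j) (a j) (δ j) (congrFun h1 j) ?_
    refine key _ _ ?_ _ _ h2 j
    funext j
    rw [← (D j).subTy_comp]
    exact congrArg _ (congrFun h1 j)

end CwF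

namespace CwFHom

variable {C : CwF.{u, v, w, x}} {D : CwF.{u', v', w', x'}}

theorem map_heq (F : CwFHom C D) {Δ Γ Δ' Γ' : C.Ctx} {f : C.Hom Δ Γ} {f' : C.Hom Δ' Γ'}
    (h1 : Δ = Δ') (h2 : Γ = Γ') (h : HEq f f') : HEq (F.map f) (F.map f') := by
  subst h1; subst h2; cases h; rfl

theorem mapTy_heq (F : CwFHom C D) {Γ Γ' : C.Ctx} {A : C.Ty Γ} {A' : C.Ty Γ'}
    (h2 : Γ = Γ') (h : HEq A A') : HEq (F.mapTy A) (F.mapTy A') := by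
  subst h2; cases h; rfl

theorem mapTm_heq (F : CwFHom C D) {Γ Γ' : C.Ctx} {A : C.Ty Γ} {A' : C.Ty Γ'}
    {a : C.Tm Γ A} {a' : C.Tm Γ' A'}
    (h2 : Γ = Γ') (h : HEq A A') (h' : HEq a a') : HEq (F.mapTm a) (F.mapTm a') := by
  subst h2; cases h; cases h'; rfl

theorem map_bang_s12 (F : CwFHom C D) (Γ : C.Ctx) : HEq (F.map (C.bang Γ)) (D.bang (F.obj Γ)) := by
  have key : ∀ (X : D.Ctx) (_ : X = D.one) (f : D.Hom (F.obj Γ) X), HEq f (D.bang (F.obj Γ)) := by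
    intro X hX f
    subst hX
    exact heq_of_eq (D.bang_unique f)
  exact key _ F.obj_one _

theorem map_pair_s12 (F : CwFHom C D) {Δ Γ : C.Ctx} (A : C.Ty Γ) (γ : C.Hom Δ Γ)
    (a : C.Tm Δ (C.subTy A γ)) (b : D.Tm (F.obj Δ) (D.subTy (F.mapTy A) (F.map γ)))
    (hb : HEq (F.mapTm a) b) :
    HEq (F.map (C.pair A γ a)) (D.pair (F.mapTy A) (F.map γ) b) := by
  have hq : HEq (cast (by rw [F.mapTy_sub]) (F.mapTm (C.q A)) :
      D.Tm (F.obj (C.ext Γ A)) (D.subTy (F.mapTy A) (F.map (C.p A)))) (F.mapTm (C.q A)) :=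
    cast_heq _ _
  refine D.pair_unique_heq_s12 (F.mapTy A) (F.map γ) b (F.obj_ext A) _ (F.map (C.p A)) (F.map_p A)
    (cast (by rw [F.mapTy_sub]) (F.mapTm (C.q A))) (hq.trans (F.map_q A)) ?_ ?_
  · rw [← F.map_comp, C.p_pair]
  · refine (D.subTm_heq_s12 rfl rfl (heq_of_eq (F.mapTy_sub _ _).symm) hq HEq.rfl).trans ?_
    refine (F.mapTm_sub _ _).symm.trans ?_
    refine HEq.trans ?_ hb
    refine F.mapTm_heq rfl ?_ (C.q_pair A γ a)
    rw [← C.subTy_comp, C.p_pair]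

/-- Action of a morphism on elements. -/
def el (F : CwFHom C D) : C.El → D.El
  | .ctx Γ => .ctx (F.obj Γ)
  | .hom f => .hom (F.map f)
  | .ty A => .ty (F.mapTy A)
  | .tm a => .tm (F.mapTm a)

theorem ext_el (F G : CwFHom C D) (h : ∀ e, F.el e = G.el e) : F = G := by
  obtain ⟨o, m, _, _, t, s, _, _, _, _, _, _⟩ := F
  obtain ⟨o', m', _, _, t', s', _, _, _, _, _, _⟩ := G
  obtain rfl : o = o' := funext fun Γ => by
    have := h (.ctx Γ); simpa [el] using this
  have h1 : @m = @m' := by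
    funext Δ Γ f
    have := h (.hom f); simpa [el] using this
  have h2 : @t = @t' := by
    funext Γ A
    have := h (.ty A); simpa [el] using this
  subst h1; subst h2
  have h3 : @s = @s' := by
    funext Γ A a
    have := h (.tm a); simpa [el] using this
  subst h3
  rfl

/-- Composition of strict cwf-morphisms. -/
def comp {E : CwF.{u, v, w, x}} {E' : CwF.{u', v', w', x'}} {E'' : CwF.{u₂, v₂, w₂, x₂}}
    (F : CwFHom E' E'') (G : CwFHom E E') : CwFHom E E'' where
  obj Γ := F.obj (G.obj Γ)
  map f := F.map (G.map f)
  map_id Γ := by rw [G.map_id, F.map_id]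
  map_comp γ δ := by rw [G.map_comp, F.map_comp]
  mapTy A := F.mapTy (G.mapTy A)
  mapTm a := F.mapTm (G.mapTm a)
  mapTy_sub A γ := by rw [G.mapTy_sub, F.mapTy_sub]
  mapTm_sub a γ := (F.mapTm_heq rfl (heq_of_eq (G.mapTy_sub _ _)) (G.mapTm_sub a γ)).trans
    (F.mapTm_sub _ _)
  obj_one := by rw [G.obj_one, F.obj_one]
  obj_ext A := by rw [G.obj_ext, F.obj_ext]
  map_p A := (F.map_heq (G.obj_ext A) rfl (G.map_p A)).trans (F.map_p _)
  map_q A := (F.mapTm_heq (G.obj_ext A) ((heq_of_eq (G.mapTy_sub _ _)).trans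
    (E'.subTy_heq_s12 (G.obj_ext A) rfl HEq.rfl (G.map_p A))) (G.map_q A)).trans (F.map_q _)

/-- Projection from a product. -/
def proj {J : Type u'} (D : J → CwF.{u, v, w, x}) (j : J) : CwFHom (CwF.prod_s12 D) (D j) where
  obj Γ := Γ j
  map f := f j
  map_id _ := rfl
  map_comp _ _ := rfl
  mapTy A := A j
  mapTm a := a j
  mapTy_sub _ _ := rfl
  mapTm_sub _ _ := HEq.rfl
  obj_one := rfl
  obj_ext _ := rfl
  map_p _ := HEq.rfl
  map_q _ := HEq.rfl

/-- Tupling into a product. -/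
def tuple {J : Type u'} (D : J → CwF.{u, v, w, x}) {B : CwF.{u₂, v₂, w₂, x₂}}
    (F : ∀ j, CwFHom B (D j)) : CwFHom B (CwF.prod_s12 D) where
  obj Γ := fun j => (F j).obj Γ
  map f := fun j => (F j).map f
  map_id _ := funext fun j => (F j).map_id _
  map_comp _ _ := funext fun j => (F j).map_comp _ _
  mapTy A := fun j => (F j).mapTy A
  mapTm a := fun j => (F j).mapTm a
  mapTy_sub _ _ := funext fun j => (F j).mapTy_sub _ _
  mapTm_sub _ _ := Function.hfunext rfl fun j j' h => by
    cases h; exact (F j).mapTm_sub _ _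
  obj_one := funext fun j => (F j).obj_one
  obj_ext _ := funext fun j => (F j).obj_ext _
  map_p _ := Function.hfunext rfl fun j j' h => by
    cases h; exact (F j).map_p _
  map_q _ := Function.hfunext rfl fun j j' h => by
    cases h; exact (F j).map_q _

end CwFHom

/-- A small set of elements of a cwf closed under the cwf operations. -/
structure SubData (P : CwF.{u', v', w', x'}) where
  G : P.El → Prop
  small : Small.{u} {e : P.El // G e}
  one : G (.ctx P.one)
  step : ∀ {k : ℕ} {e₁ e₂ e₃ e : P.El}, P.Step k e₁ e₂ e₃ e → G e₁ → G e₂ → G e₃ → G e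

namespace SubData

variable {P : CwF.{u', v', w', x'}} (s : SubData.{u} P)

instance : Small.{u} {Γ : P.Ctx // s.G (.ctx Γ)} :=
  have := s.small
  small_of_injective (β := {e : P.El // s.G e}) (f := fun Γ => ⟨.ctx Γ.1, Γ.2⟩) (by
    rintro ⟨a, _⟩ ⟨b, _⟩ h; simpa using h)

instance (Δ Γ : P.Ctx) : Small.{u} {f : P.Hom Δ Γ // s.G (.hom f)} :=
  have := s.small
  small_of_injective (β := {e : P.El // s.G e}) (f := fun Γ => ⟨.hom Γ.1, Γ.2⟩) (by
    rintro ⟨a, _⟩ ⟨b, _⟩ h; simpa using h)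

instance (Γ : P.Ctx) : Small.{u} {A : P.Ty Γ // s.G (.ty A)} :=
  have := s.small
  small_of_injective (β := {e : P.El // s.G e}) (f := fun Γ => ⟨.ty Γ.1, Γ.2⟩) (by
    rintro ⟨a, _⟩ ⟨b, _⟩ h; simpa using h)

instance (Γ : P.Ctx) (A : P.Ty Γ) : Small.{u} {a : P.Tm Γ A // s.G (.tm a)} :=
  have := s.small
  small_of_injective (β := {e : P.El // s.G e}) (f := fun Γ => ⟨.tm Γ.1, Γ.2⟩) (by
    rintro ⟨a, _⟩ ⟨b, _⟩ h; simpa using h)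

/-- Small contexts. -/
def X : Type u := Shrink.{u} {Γ : P.Ctx // s.G (.ctx Γ)}
/-- Small homs. -/
def H (Δ Γ : P.Ctx) : Type u := Shrink.{u} {f : P.Hom Δ Γ // s.G (.hom f)}
/-- Small types. -/
def T (Γ : P.Ctx) : Type u := Shrink.{u} {A : P.Ty Γ // s.G (.ty A)}
/-- Small terms. -/
def M (Γ : P.Ctx) (A : P.Ty Γ) : Type u := Shrink.{u} {a : P.Tm Γ A // s.G (.tm a)}

/-- Realization of contexts. -/
noncomputable def r (y : s.X) : P.Ctx := ((equivShrink _).symm y).1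
/-- Realization of homs. -/
noncomputable def rH {Δ Γ : P.Ctx} (f : s.H Δ Γ) : P.Hom Δ Γ := ((equivShrink _).symm f).1
/-- Realization of types. -/
noncomputable def rT {Γ : P.Ctx} (A : s.T Γ) : P.Ty Γ := ((equivShrink _).symm A).1
/-- Realization of terms. -/
noncomputable def rM {Γ : P.Ctx} {A : P.Ty Γ} (a : s.M Γ A) : P.Tm Γ A :=
  ((equivShrink _).symm a).1

theorem r_good (y : s.X) : s.G (.ctx (s.r y)) := ((equivShrink _).symm y).2
theorem rH_good {Δ Γ : P.Ctx} (f : s.H Δ Γ) : s.G (.hom (s.rH f)) := ((equivShrink _).symm f).2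
theorem rT_good {Γ : P.Ctx} (A : s.T Γ) : s.G (.ty (s.rT A)) := ((equivShrink _).symm A).2
theorem rM_good {Γ : P.Ctx} {A : P.Ty Γ} (a : s.M Γ A) : s.G (.tm (s.rM a)) :=
  ((equivShrink _).symm a).2

theorem r_inj {y z : s.X} (h : s.r y = s.r z) : y = z :=
  (equivShrink _).symm.injective (Subtype.ext h)
theorem rH_inj {Δ Γ : P.Ctx} {f g : s.H Δ Γ} (h : s.rH f = s.rH g) : f = g :=
  (equivShrink _).symm.injective (Subtype.ext h)
theorem rT_inj {Γ : P.Ctx} {f g : s.T Γ} (h : s.rT f = s.rT g) : f = g :=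
  (equivShrink _).symm.injective (Subtype.ext h)
theorem rM_inj {Γ : P.Ctx} {A : P.Ty Γ} {f g : s.M Γ A} (h : s.rM f = s.rM g) : f = g :=
  (equivShrink _).symm.injective (Subtype.ext h)

theorem rH_hinj {Δ Γ Δ' Γ' : P.Ctx} {f : s.H Δ Γ} {g : s.H Δ' Γ'} (h1 : Δ = Δ') (h2 : Γ = Γ')
    (h : HEq (s.rH f) (s.rH g)) : HEq f g := by
  subst h1; subst h2; exact heq_of_eq (s.rH_inj (eq_of_heq h))
theorem rT_hinj {Γ Γ' : P.Ctx} {f : s.T Γ} {g : s.T Γ'} (h2 : Γ = Γ')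
    (h : HEq (s.rT f) (s.rT g)) : HEq f g := by
  subst h2; exact heq_of_eq (s.rT_inj (eq_of_heq h))
theorem rM_hinj {Γ Γ' : P.Ctx} {A : P.Ty Γ} {A' : P.Ty Γ'} {f : s.M Γ A} {g : s.M Γ' A'}
    (h2 : Γ = Γ') (h3 : HEq A A')
    (h : HEq (s.rM f) (s.rM g)) : HEq f g := by
  subst h2; cases h3; exact heq_of_eq (s.rM_inj (eq_of_heq h))

theorem ex (Γ : P.Ctx) (h : s.G (.ctx Γ)) : ∃ y, s.r y = Γ :=
  ⟨equivShrink _ ⟨Γ, h⟩, by simp [r]⟩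
theorem exH {y z : s.X} {Δ Γ : P.Ctx} (f : P.Hom Δ Γ) (h : s.G (.hom f)) (h1 : s.r y = Δ)
    (h2 : s.r z = Γ) : ∃ g : s.H (s.r y) (s.r z), HEq (s.rH g) f := by
  subst h1; subst h2
  exact ⟨equivShrink _ ⟨f, h⟩, by simp [rH]⟩
theorem exT {y : s.X} {Γ : P.Ctx} (f : P.Ty Γ) (h : s.G (.ty f))
    (h2 : s.r y = Γ) : ∃ g : s.T (s.r y), HEq (s.rT g) f := by
  subst h2
  exact ⟨equivShrink _ ⟨f, h⟩, by simp [rT]⟩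
theorem exM {y : s.X} {B : s.T (s.r y)} {Γ : P.Ctx} {A : P.Ty Γ} (f : P.Tm Γ A) (h : s.G (.tm f))
    (h2 : s.r y = Γ) (h3 : HEq (s.rT B) A) : ∃ g : s.M (s.r y) (s.rT B), HEq (s.rM g) f := by
  subst h2; cases h3
  exact ⟨equivShrink _ ⟨f, h⟩, by simp [rM]⟩

/-- Context from a good context. -/
noncomputable def mkX (Γ : P.Ctx) (h : s.G (.ctx Γ)) : s.X := (s.ex Γ h).choose
theorem r_mkX (Γ : P.Ctx) (h : s.G (.ctx Γ)) : s.r (s.mkX Γ h) = Γ := (s.ex Γ h).choose_spec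
/-- Hom from a good hom. -/
noncomputable def mkH {y z : s.X} {Δ Γ : P.Ctx} (f : P.Hom Δ Γ) (h : s.G (.hom f))
    (h1 : s.r y = Δ) (h2 : s.r z = Γ) : s.H (s.r y) (s.r z) := (s.exH f h h1 h2).choose
theorem r_mkH {y z : s.X} {Δ Γ : P.Ctx} (f : P.Hom Δ Γ) (h : s.G (.hom f))
    (h1 : s.r y = Δ) (h2 : s.r z = Γ) : HEq (s.rH (s.mkH f h h1 h2)) f :=
  (s.exH f h h1 h2).choose_spec
/-- Type from a good type. -/
noncomputable def mkT {y : s.X} {Γ : P.Ctx} (f : P.Ty Γ) (h : s.G (.ty f))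
    (h2 : s.r y = Γ) : s.T (s.r y) := (s.exT f h h2).choose
theorem r_mkT {y : s.X} {Γ : P.Ctx} (f : P.Ty Γ) (h : s.G (.ty f))
    (h2 : s.r y = Γ) : HEq (s.rT (s.mkT f h h2)) f := (s.exT f h h2).choose_spec
/-- Term from a good term. -/
noncomputable def mkM {y : s.X} {B : s.T (s.r y)} {Γ : P.Ctx} {A : P.Ty Γ} (f : P.Tm Γ A)
    (h : s.G (.tm f)) (h2 : s.r y = Γ) (h3 : HEq (s.rT B) A) : s.M (s.r y) (s.rT B) :=
  (s.exM f h h2 h3).choose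
theorem r_mkM {y : s.X} {B : s.T (s.r y)} {Γ : P.Ctx} {A : P.Ty Γ} (f : P.Tm Γ A)
    (h : s.G (.tm f)) (h2 : s.r y = Γ) (h3 : HEq (s.rT B) A) :
    HEq (s.rM (s.mkM f h h2 h3)) f :=
  (s.exM f h h2 h3).choose_spec

/-- identity -/
noncomputable def id' (y : s.X) : s.H (s.r y) (s.r y) :=
  s.mkH (P.id (s.r y)) (s.step (.id _) (s.r_good y) (s.r_good y) (s.r_good y)) rfl rfl
theorem r_id (y : s.X) : s.rH (s.id' y) = P.id (s.r y) := eq_of_heq (s.r_mkH ..)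
/-- composition -/
noncomputable def comp' {x y z : s.X} (f : s.H (s.r y) (s.r z)) (g : s.H (s.r x) (s.r y)) :
    s.H (s.r x) (s.r z) :=
  s.mkH (P.comp (s.rH f) (s.rH g)) (s.step (.comp _ _) (s.rH_good _) (s.rH_good _) (s.rH_good _))
    rfl rfl
theorem r_comp {x y z : s.X} (f : s.H (s.r y) (s.r z)) (g : s.H (s.r x) (s.r y)) :
    s.rH (s.comp' f g) = P.comp (s.rH f) (s.rH g) := eq_of_heq (s.r_mkH ..)
/-- type substitution -/
noncomputable def subTy' {x y : s.X} (A : s.T (s.r y)) (g : s.H (s.r x) (s.r y)) :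
    s.T (s.r x) :=
  s.mkT (P.subTy (s.rT A) (s.rH g))
    (s.step (.subTy _ _) (s.rT_good _) (s.rH_good _) (s.rH_good _)) rfl
theorem r_subTy {x y : s.X} (A : s.T (s.r y)) (g : s.H (s.r x) (s.r y)) :
    s.rT (s.subTy' A g) = P.subTy (s.rT A) (s.rH g) := eq_of_heq (s.r_mkT ..)
/-- term substitution -/
noncomputable def subTm' {x y : s.X} {A : s.T (s.r y)} (a : s.M (s.r y) (s.rT A))
    (g : s.H (s.r x) (s.r y)) : s.M (s.r x) (s.rT (s.subTy' A g)) :=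
  s.mkM (P.subTm (s.rM a) (s.rH g))
    (s.step (.subTm _ _) (s.rM_good _) (s.rH_good _) (s.rH_good _)) rfl
    (heq_of_eq (s.r_subTy A g))
theorem r_subTm {x y : s.X} {A : s.T (s.r y)} (a : s.M (s.r y) (s.rT A))
    (g : s.H (s.r x) (s.r y)) : HEq (s.rM (s.subTm' a g)) (P.subTm (s.rM a) (s.rH g)) :=
  s.r_mkM ..
/-- terminal context -/
noncomputable def one' : s.X := s.mkX P.one s.one
theorem r_one : s.r s.one' = P.one := s.r_mkX _ _
/-- terminal map -/
noncomputable def bang' (y : s.X) : s.H (s.r y) (s.r s.one') :=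
  s.mkH (P.bang (s.r y)) (s.step (.bang _) (s.r_good y) (s.r_good y) (s.r_good y)) rfl s.r_one
/-- context extension -/
noncomputable def ext' (y : s.X) (A : s.T (s.r y)) : s.X :=
  s.mkX (P.ext (s.r y) (s.rT A)) (s.step (.ext _) (s.rT_good _) (s.rT_good _) (s.rT_good _))
theorem r_ext (y : s.X) (A : s.T (s.r y)) : s.r (s.ext' y A) = P.ext (s.r y) (s.rT A) :=
  s.r_mkX _ _
/-- first projection -/
noncomputable def p' {y : s.X} (A : s.T (s.r y)) : s.H (s.r (s.ext' y A)) (s.r y) :=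
  s.mkH (P.p (s.rT A)) (s.step (.p _) (s.rT_good _) (s.rT_good _) (s.rT_good _)) (s.r_ext y A) rfl
theorem r_p {y : s.X} (A : s.T (s.r y)) : HEq (s.rH (s.p' A)) (P.p (s.rT A)) := s.r_mkH ..
theorem r_subTy_p {y : s.X} (A : s.T (s.r y)) :
    HEq (s.rT (s.subTy' A (s.p' A))) (P.subTy (s.rT A) (P.p (s.rT A))) :=
  (heq_of_eq (s.r_subTy _ _)).trans (P.subTy_heq_s12 (s.r_ext _ _) rfl HEq.rfl (s.r_p A))
/-- second projection -/
noncomputable def q' {y : s.X} (A : s.T (s.r y)) :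
    s.M (s.r (s.ext' y A)) (s.rT (s.subTy' A (s.p' A))) :=
  s.mkM (P.q (s.rT A)) (s.step (.q _) (s.rT_good _) (s.rT_good _) (s.rT_good _)) (s.r_ext y A)
    (s.r_subTy_p A)
theorem r_q {y : s.X} (A : s.T (s.r y)) : HEq (s.rM (s.q' A)) (P.q (s.rT A)) := s.r_mkM ..

theorem ex_cast {x y : s.X} (A : s.T (s.r y)) (γ : s.H (s.r x) (s.r y))
    (a : s.M (s.r x) (s.rT (s.subTy' A γ))) :
    ∃ b : P.Tm (s.r x) (P.subTy (s.rT A) (s.rH γ)), HEq b (s.rM a) ∧ s.G (.tm b) := by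
  have key : ∀ (B B' : P.Ty (s.r x)) (_ : B = B') (c : P.Tm (s.r x) B), s.G (.tm c) →
      ∃ b : P.Tm (s.r x) B', HEq b c ∧ s.G (.tm b) := by
    intro B B' h c hc; subst h; exact ⟨c, HEq.rfl, hc⟩
  exact key _ _ (s.r_subTy A γ) _ (s.rM_good a)
/-- cast term -/
noncomputable def ct {x y : s.X} (A : s.T (s.r y)) (γ : s.H (s.r x) (s.r y))
    (a : s.M (s.r x) (s.rT (s.subTy' A γ))) : P.Tm (s.r x) (P.subTy (s.rT A) (s.rH γ)) :=
  (s.ex_cast A γ a).choose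
theorem ct_heq {x y : s.X} (A : s.T (s.r y)) (γ : s.H (s.r x) (s.r y))
    (a : s.M (s.r x) (s.rT (s.subTy' A γ))) : HEq (s.ct A γ a) (s.rM a) :=
  (s.ex_cast A γ a).choose_spec.1
theorem ct_good {x y : s.X} (A : s.T (s.r y)) (γ : s.H (s.r x) (s.r y))
    (a : s.M (s.r x) (s.rT (s.subTy' A γ))) : s.G (.tm (s.ct A γ a)) :=
  (s.ex_cast A γ a).choose_spec.2
/-- pairing -/
noncomputable def pair' {x y : s.X} (A : s.T (s.r y)) (γ : s.H (s.r x) (s.r y))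
    (a : s.M (s.r x) (s.rT (s.subTy' A γ))) : s.H (s.r x) (s.r (s.ext' y A)) :=
  s.mkH (P.pair (s.rT A) (s.rH γ) (s.ct A γ a))
    (s.step (.pair _ _ _) (s.rT_good _) (s.rH_good _) (s.ct_good A γ a)) rfl (s.r_ext y A)
theorem r_pair {x y : s.X} (A : s.T (s.r y)) (γ : s.H (s.r x) (s.r y))
    (a : s.M (s.r x) (s.rT (s.subTy' A γ))) :
    HEq (s.rH (s.pair' A γ a)) (P.pair (s.rT A) (s.rH γ) (s.ct A γ a)) := s.r_mkH ..

theorem p_pair' {x y : s.X} (A : s.T (s.r y)) (γ : s.H (s.r x) (s.r y))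
    (a : s.M (s.r x) (s.rT (s.subTy' A γ))) : s.comp' (s.p' A) (s.pair' A γ a) = γ := by
  apply s.rH_inj
  rw [r_comp]
  apply eq_of_heq
  refine (P.comp_heq_s12 rfl (s.r_ext _ _) rfl (s.r_p A) (s.r_pair A γ a)).trans ?_
  rw [P.p_pair]

/-- The small cwf presented by a small closed set of elements. -/
noncomputable def toCwF : CwF.{u, u, u, u} where
  Ctx := s.X
  Hom y z := s.H (s.r y) (s.r z)
  id := s.id'
  comp := s.comp'
  id_comp γ := s.rH_inj (by rw [r_comp, r_id, P.id_comp])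
  comp_id γ := s.rH_inj (by rw [r_comp, r_id, P.comp_id])
  comp_assoc γ δ ξ := s.rH_inj (by simp only [r_comp, P.comp_assoc])
  Ty y := s.T (s.r y)
  Tm y A := s.M (s.r y) (s.rT A)
  subTy := s.subTy'
  subTm := s.subTm'
  subTy_id A := s.rT_inj (by rw [r_subTy, r_id, P.subTy_id])
  subTy_comp A γ δ := s.rT_inj (by simp only [r_subTy, r_comp, P.subTy_comp])
  subTm_id a := by
    refine s.rM_hinj rfl (heq_of_eq (by rw [r_subTy, r_id, P.subTy_id])) ?_
    refine (s.r_subTm _ _).trans ?_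
    rw [r_id]
    exact P.subTm_id _
  subTm_comp a γ δ := by
    refine s.rM_hinj rfl (heq_of_eq (by simp only [r_subTy, r_comp, P.subTy_comp])) ?_
    refine (s.r_subTm _ _).trans ?_
    rw [r_comp]
    refine (P.subTm_comp _ _ _).trans ?_
    refine HEq.trans ?_ (s.r_subTm _ _).symm
    exact P.subTm_heq_s12 rfl rfl (heq_of_eq (s.r_subTy _ _).symm) (s.r_subTm _ _).symm HEq.rfl
  one := s.one'
  bang := s.bang'
  bang_unique {y} γ := by
    have key : ∀ (X : P.Ctx) (_ : X = P.one) (f g : P.Hom (s.r y) X), f = g := by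
      intro X hX f g
      subst hX
      rw [P.bang_unique f, P.bang_unique g]
    exact s.rH_inj (key _ s.r_one _ _)
  ext := s.ext'
  p := s.p'
  q := s.q'
  pair := s.pair'
  p_pair := s.p_pair'
  q_pair A γ a := by
    have h := s.p_pair' A γ a
    refine s.rM_hinj rfl (heq_of_eq ?_) ?_
    · conv_rhs => rw [← h]
      simp only [r_subTy, r_comp, P.subTy_comp]
    · refine (s.r_subTm _ _).trans ?_
      refine (P.subTm_heq_s12 rfl (s.r_ext _ _) (s.r_subTy_p A) (s.r_q A) (s.r_pair A γ a)).trans ?_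
      exact (P.q_pair _ _ _).trans (s.ct_heq A γ a)
  pair_unique A γ a δ h1 h2 := by
    apply s.rH_inj
    apply eq_of_heq
    refine HEq.trans ?_ (s.r_pair A γ a).symm
    have hq : HEq (cast (by rw [s.r_subTy]) (s.rM (s.q' A)) :
      P.Tm (s.r (s.ext' _ A)) (P.subTy (s.rT A) (s.rH (s.p' A)))) (s.rM (s.q' A)) :=
      cast_heq _ _
    refine P.pair_unique_heq_s12 _ _ _ (s.r_ext _ A) _ (s.rH (s.p' A)) (s.r_p A)
      (cast (by rw [s.r_subTy]) (s.rM (s.q' A))) (hq.trans (s.r_q A)) ?_ ?_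
    · rw [← r_comp, h1]
    · refine (P.subTm_heq_s12 rfl rfl (heq_of_eq (s.r_subTy _ _).symm) hq HEq.rfl).trans ?_
      refine (s.r_subTm _ _).symm.trans ?_
      refine HEq.trans ?_ (s.ct_heq A γ a).symm
      have key : ∀ (y : P.Ctx) (B B' : P.Ty y) (_ : B = B') (c : s.M y B) (c' : s.M y B'),
          HEq c c' → HEq (s.rM c) (s.rM c') := by
        intro y B B' h c c' hc; subst h; cases hc; rfl
      refine key _ _ _ ?_ _ _ h2
      rw [← h1]
      simp only [r_subTy, r_comp, P.subTy_comp]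

theorem id_heq' (P : CwF.{u', v', w', x'}) {Γ Γ' : P.Ctx} (h : Γ = Γ') :
    HEq (P.id Γ) (P.id Γ') := by
  subst h; rfl

/-- The inclusion. -/
noncomputable def incl : CwFHom s.toCwF P where
  obj := s.r
  map := s.rH
  map_id := s.r_id
  map_comp := s.r_comp
  mapTy := s.rT
  mapTm := s.rM
  mapTy_sub := s.r_subTy
  mapTm_sub := s.r_subTm
  obj_one := s.r_one
  obj_ext A := s.r_ext _ A
  map_p := s.r_p
  map_q := s.r_q

/-- Lifting along the inclusion. -/
noncomputable def lift {C : CwF.{u₂, v₂, w₂, x₂}} (F : CwFHom C P) (h : ∀ e, s.G (F.el e)) :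
    CwFHom C s.toCwF where
  obj Γ := s.mkX (F.obj Γ) (h (.ctx Γ))
  map f := s.mkH (F.map f) (h (.hom f)) (s.r_mkX _ _) (s.r_mkX _ _)
  map_id Γ := by
    apply s.rH_inj
    apply eq_of_heq
    refine (s.r_mkH ..).trans ?_
    refine HEq.trans ?_ (heq_of_eq (s.r_id _).symm)
    rw [F.map_id]
    exact id_heq' P (s.r_mkX _ (h (.ctx Γ))).symm
  map_comp γ δ := by
    apply s.rH_inj
    apply eq_of_heq
    refine (s.r_mkH ..).trans ?_
    refine HEq.trans ?_ (heq_of_eq (s.r_comp _ _).symm)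
    rw [F.map_comp]
    exact P.comp_heq_s12 (s.r_mkX _ _).symm (s.r_mkX _ _).symm (s.r_mkX _ _).symm
      (s.r_mkH ..).symm (s.r_mkH ..).symm
  mapTy A := s.mkT (F.mapTy A) (h (.ty A)) (s.r_mkX _ _)
  mapTm a := s.mkM (F.mapTm a) (h (.tm a)) (s.r_mkX _ _) (s.r_mkT _ _ _)
  mapTy_sub A γ := by
    apply s.rT_inj
    apply eq_of_heq
    refine (s.r_mkT ..).trans ?_
    refine HEq.trans ?_ (heq_of_eq (s.r_subTy _ _).symm)
    rw [F.mapTy_sub]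
    exact P.subTy_heq_s12 (s.r_mkX _ _).symm (s.r_mkX _ _).symm (s.r_mkT ..).symm (s.r_mkH ..).symm
  mapTm_sub a γ := by
    refine s.rM_hinj rfl ?_ ?_
    · refine (s.r_mkT ..).trans ?_
      refine HEq.trans ?_ (heq_of_eq (s.r_subTy _ _).symm)
      rw [F.mapTy_sub]
      exact P.subTy_heq_s12 (s.r_mkX _ _).symm (s.r_mkX _ _).symm (s.r_mkT ..).symm (s.r_mkH ..).symm
    · refine (s.r_mkM ..).trans ?_
      refine HEq.trans ?_ (s.r_subTm _ _).symm
      refine (F.mapTm_sub _ _).trans ?_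
      exact P.subTm_heq_s12 (s.r_mkX _ _).symm (s.r_mkX _ _).symm (s.r_mkT ..).symm (s.r_mkM ..).symm
        (s.r_mkH ..).symm
  obj_one := s.r_inj ((s.r_mkX _ _).trans (F.obj_one.trans s.r_one.symm))
  obj_ext A := s.r_inj ((s.r_mkX _ _).trans ((F.obj_ext A).trans
    ((P.ext_heq (s.r_mkX _ _).symm (s.r_mkT ..).symm).trans (s.r_ext _ _).symm)))
  map_p A := by
    refine s.rH_hinj ?_ rfl ?_
    · exact ((s.r_mkX _ _).trans ((F.obj_ext A).trans
        ((P.ext_heq (s.r_mkX _ _).symm (s.r_mkT ..).symm).trans (s.r_ext _ _).symm)))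
    · refine (s.r_mkH ..).trans ((F.map_p A).trans ?_)
      exact (P.p_heq_s12 (s.r_mkX _ _).symm (s.r_mkT ..).symm).trans (s.r_p _).symm
  map_q A := by
    refine s.rM_hinj ?_ ?_ ?_
    · exact ((s.r_mkX _ _).trans ((F.obj_ext A).trans
        ((P.ext_heq (s.r_mkX _ _).symm (s.r_mkT ..).symm).trans (s.r_ext _ _).symm)))
    · refine (s.r_mkT ..).trans ?_
      refine HEq.trans ?_ (s.r_subTy_p _).symm
      rw [F.mapTy_sub]
      refine (P.subTy_heq_s12 (F.obj_ext A) rfl HEq.rfl (F.map_p A)).trans ?_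
      exact P.subTy_heq_s12 (P.ext_heq (s.r_mkX _ _).symm (s.r_mkT ..).symm) (s.r_mkX _ _).symm
        (s.r_mkT ..).symm (P.p_heq_s12 (s.r_mkX _ _).symm (s.r_mkT ..).symm)
    · refine (s.r_mkM ..).trans ((F.map_q A).trans ?_)
      exact (P.q_heq_s12 (s.r_mkX _ _).symm (s.r_mkT ..).symm).trans (s.r_q _).symm

theorem incl_lift {C : CwF.{u₂, v₂, w₂, x₂}} (F : CwFHom C P) (h : ∀ e, s.G (F.el e)) :
    s.incl.comp (s.lift F h) = F := by
  apply CwFHom.ext_el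
  rintro (Γ | f | A | a)
  · exact congrArg CwF.El.ctx (s.r_mkX (F.obj Γ) (h (.ctx Γ)))
  · exact CwF.El.hom_eq (s.r_mkX _ (h (.ctx _))) (s.r_mkX _ (h (.ctx _)))
      (s.r_mkH _ (h (.hom f)) (s.r_mkX _ (h (.ctx _))) (s.r_mkX _ (h (.ctx _))))
  · exact CwF.El.ty_eq (s.r_mkX _ (h (.ctx _))) (s.r_mkT _ (h (.ty A)) (s.r_mkX _ (h (.ctx _))))
  · exact CwF.El.tm_eq (s.r_mkX _ (h (.ctx _)))
      (s.r_mkT _ (h (.ty _)) (s.r_mkX _ (h (.ctx _))))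
      (s.r_mkM _ (h (.tm a)) (s.r_mkX _ (h (.ctx _)))
        (s.r_mkT _ (h (.ty _)) (s.r_mkX _ (h (.ctx _)))))

theorem incl_good (e : s.toCwF.El) : s.G (s.incl.el e) := by
  rcases e with (Γ | f | A | a)
  · exact s.r_good _
  · exact s.rH_good _
  · exact s.rT_good _
  · exact s.rM_good _

theorem incl_inj (e e' : s.toCwF.El) (h : s.incl.el e = s.incl.el e') : e = e' := by
  rcases e with (Γ | ⟨f⟩ | ⟨A⟩ | @⟨Γ, A, a⟩) <;> rcases e' with (Γ' | ⟨f'⟩ | ⟨A'⟩ | @⟨Γ', A', a'⟩) <;>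
    simp only [CwFHom.el] at h <;> injection h
  · rename_i h; exact congrArg _ (s.r_inj h)
  · rename_i h1 h2 h3
    exact CwF.El.hom_eq (s.r_inj h1) (s.r_inj h2) (s.rH_hinj h1 h2 h3)
  · rename_i h1 h2
    exact CwF.El.ty_eq (s.r_inj h1) (s.rT_hinj h1 h2)
  · rename_i h1 h2 h3
    exact CwF.El.tm_eq (s.r_inj h1) (s.rT_hinj h1 h2) (s.rM_hinj h1 h2 h3)

end SubData

theorem CwFHom.step_map {C : CwF.{u, v, w, x}} {D : CwF.{u', v', w', x'}} (F : CwFHom C D)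
    {k : ℕ} {e₁ e₂ e₃ e : C.El} (h : C.Step k e₁ e₂ e₃ e) :
    D.Step k (F.el e₁) (F.el e₂) (F.el e₃) (F.el e) := by
  cases h with
  | id Γ => simp only [el, F.map_id]; exact .id _
  | comp γ δ => simp only [el, F.map_comp]; exact .comp _ _
  | subTy A γ => simp only [el, F.mapTy_sub]; exact .subTy _ _
  | subTm a γ =>
    have : F.el (.tm (C.subTm a γ)) = .tm (D.subTm (F.mapTm a) (F.map γ)) :=
      CwF.El.tm_eq rfl (heq_of_eq (F.mapTy_sub _ _)) (F.mapTm_sub _ _)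
    rw [this]; exact .subTm _ _
  | bang Γ =>
    have : F.el (.hom (C.bang Γ)) = .hom (D.bang (F.obj Γ)) :=
      CwF.El.hom_eq rfl F.obj_one (F.map_bang_s12 _)
    rw [this]; exact .bang _
  | ext A => simp only [el, F.obj_ext]; exact .ext _
  | p A =>
    have : F.el (.hom (C.p A)) = .hom (D.p (F.mapTy A)) :=
      CwF.El.hom_eq (F.obj_ext _) rfl (F.map_p _)
    rw [this]; exact .p _
  | q A =>
    have : F.el (.tm (C.q A)) = .tm (D.q (F.mapTy A)) :=
      CwF.El.tm_eq (F.obj_ext _) ((heq_of_eq (F.mapTy_sub _ _)).trans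
        (D.subTy_heq_s12 (F.obj_ext A) rfl HEq.rfl (F.map_p A))) (F.map_q _)
    rw [this]; exact .q _
  | pair A γ a =>
    obtain ⟨b, hb⟩ : ∃ b : D.Tm _ (D.subTy (F.mapTy A) (F.map γ)), HEq (F.mapTm a) b :=
      ⟨cast (by rw [F.mapTy_sub]) (F.mapTm a), (cast_heq _ _).symm⟩
    have h1 : F.el (.tm a) = .tm b := CwF.El.tm_eq rfl (heq_of_eq (F.mapTy_sub _ _)) hb
    have h2 : F.el (.hom (C.pair A γ a)) = .hom (D.pair _ _ b) :=
      CwF.El.hom_eq rfl (F.obj_ext _) (F.map_pair_s12 A γ a b hb)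
    rw [h1, h2]; exact .pair _ _ _

namespace SubData

variable {P : CwF.{u', v', w', x'}} (s : SubData.{u} P)

theorem el_ctx {e : s.toCwF.El} {Γ : P.Ctx} (h : s.incl.el e = .ctx Γ) :
    ∃ y : s.toCwF.Ctx, e = .ctx y ∧ s.r y = Γ := by
  rcases e with (y | f | A | a) <;> simp only [CwFHom.el] at h <;> injection h
  rename_i h
  exact ⟨y, rfl, h⟩

theorem el_hom {e : s.toCwF.El} {Δ Γ : P.Ctx} {f : P.Hom Δ Γ} (h : s.incl.el e = .hom f) :
    ∃ (y z : s.toCwF.Ctx) (g : s.toCwF.Hom y z), e = .hom g ∧ s.r y = Δ ∧ s.r z = Γ := by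
  rcases e with (y | g | A | a) <;> simp only [CwFHom.el] at h <;> injection h
  rename_i h1 h2 h3
  exact ⟨_, _, g, rfl, h1, h2⟩

theorem el_ty {e : s.toCwF.El} {Γ : P.Ctx} {A : P.Ty Γ} (h : s.incl.el e = .ty A) :
    ∃ (y : s.toCwF.Ctx) (B : s.toCwF.Ty y), e = .ty B ∧ s.r y = Γ ∧ HEq (s.rT B) A := by
  rcases e with (y | g | B | a) <;> simp only [CwFHom.el] at h <;> injection h
  rename_i h1 h2
  exact ⟨_, B, rfl, h1, h2⟩

theorem el_tm {e : s.toCwF.El} {Γ : P.Ctx} {A : P.Ty Γ} {a : P.Tm Γ A}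
    (h : s.incl.el e = .tm a) :
    ∃ (y : s.toCwF.Ctx) (B : s.toCwF.Ty y) (b : s.toCwF.Tm y B), e = .tm b ∧ s.r y = Γ ∧
      HEq (s.rT B) A := by
  rcases e with (y | g | B | b) <;> simp only [CwFHom.el] at h <;> injection h
  rename_i h1 h2 h3
  exact ⟨_, _, b, rfl, h1, h2⟩

theorem step_lift {k : ℕ} {e₁ e₂ e₃ : s.toCwF.El} {e : P.El}
    (h : P.Step k (s.incl.el e₁) (s.incl.el e₂) (s.incl.el e₃) e) :
    ∃ e', s.toCwF.Step k e₁ e₂ e₃ e' := by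
  generalize h₁ : s.incl.el e₁ = x₁ at h
  generalize h₂ : s.incl.el e₂ = x₂ at h
  generalize h₃ : s.incl.el e₃ = x₃ at h
  have same₂ : x₁ = x₂ → e₁ = e₂ := fun hx => s.incl_inj _ _ (by rw [h₁, h₂, hx])
  have same₃ : x₂ = x₃ → e₂ = e₃ := fun hx => s.incl_inj _ _ (by rw [h₂, h₃, hx])
  cases h with
  | id Γ =>
    obtain rfl := same₂ rfl
    obtain rfl := same₃ rfl
    obtain ⟨y, rfl, -⟩ := s.el_ctx h₁
    exact ⟨_, .id y⟩
  | comp γ δ =>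
    obtain rfl := same₃ rfl
    obtain ⟨y, z, f, rfl, hy, hz⟩ := s.el_hom h₁
    obtain ⟨y', z', f', rfl, hy', hz'⟩ := s.el_hom h₂
    obtain rfl := s.r_inj (hz'.trans hy.symm)
    exact ⟨_, .comp f f'⟩
  | subTy A γ =>
    obtain rfl := same₃ rfl
    obtain ⟨y, B, rfl, hy, -⟩ := s.el_ty h₁
    obtain ⟨y', z', f', rfl, hy', hz'⟩ := s.el_hom h₂
    obtain rfl := s.r_inj (hz'.trans hy.symm)
    exact ⟨_, .subTy B f'⟩
  | subTm a γ =>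
    obtain rfl := same₃ rfl
    obtain ⟨y, B, b, rfl, hy, -⟩ := s.el_tm h₁
    obtain ⟨y', z', f', rfl, hy', hz'⟩ := s.el_hom h₂
    obtain rfl := s.r_inj (hz'.trans hy.symm)
    exact ⟨_, .subTm b f'⟩
  | bang Γ =>
    obtain rfl := same₂ rfl
    obtain rfl := same₃ rfl
    obtain ⟨y, rfl, -⟩ := s.el_ctx h₁
    exact ⟨_, .bang y⟩
  | ext A =>
    obtain rfl := same₂ rfl
    obtain rfl := same₃ rfl
    obtain ⟨y, B, rfl, -⟩ := s.el_ty h₁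
    exact ⟨_, .ext B⟩
  | p A =>
    obtain rfl := same₂ rfl
    obtain rfl := same₃ rfl
    obtain ⟨y, B, rfl, -⟩ := s.el_ty h₁
    exact ⟨_, .p B⟩
  | q A =>
    obtain rfl := same₂ rfl
    obtain rfl := same₃ rfl
    obtain ⟨y, B, rfl, -⟩ := s.el_ty h₁
    exact ⟨_, .q B⟩
  | pair A γ a =>
    obtain ⟨y, B, rfl, hy, hB⟩ := s.el_ty h₁
    obtain ⟨y', z', f, rfl, hy', hz'⟩ := s.el_hom h₂
    obtain ⟨y'', B', b, rfl, hy'', hB'⟩ := s.el_tm h₃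
    obtain rfl := s.r_inj (hz'.trans hy.symm)
    obtain rfl := s.r_inj (hy''.trans hy'.symm)
    have hf : HEq (s.rH f) γ := by
      simp only [CwFHom.el] at h₂
      injection h₂
    obtain rfl : B' = s.toCwF.subTy B f := by
      apply s.rT_inj
      refine Eq.trans ?_ (s.r_subTy B f).symm
      exact eq_of_heq (hB'.trans (P.subTy_heq_s12 hy' hy hB hf).symm)
    exact ⟨_, .pair B f b⟩

end SubData

/-- The small closed set generated by the image of a morphism. -/
def SubData.gen {C : CwF.{u, u, u, u}} {P : CwF.{u', v', w', x'}} (F : CwFHom C P) :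
    SubData.{u} P where
  G := CwF.Clo P F.el
  small := CwF.Clo.small F.el
  one := by
    have := CwF.Clo.base (P := P) (b := F.el) (.ctx C.one)
    simpa only [CwFHom.el, F.obj_one] using this
  step := CwF.Clo.step

/-- The corestriction to the generated sub-cwf. -/
noncomputable def SubData.unit {C : CwF.{u, u, u, u}} {P : CwF.{u', v', w', x'}}
    (F : CwFHom C P) : CwFHom C (SubData.gen F).toCwF :=
  (SubData.gen F).lift F (fun e => CwF.Clo.base e)

theorem SubData.gen_unique {C : CwF.{u, u, u, u}} {P : CwF.{u', v', w', x'}} (F : CwFHom C P)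
    {D : CwF.{u₂, v₂, w₂, x₂}} (K L : CwFHom (SubData.gen F).toCwF D)
    (h : K.comp (SubData.unit F) = L.comp (SubData.unit F)) : K = L := by
  have main : ∀ e, CwF.Clo P F.el e →
      ∃ e', (SubData.gen F).incl.el e' = e ∧ K.el e' = L.el e' := by
    intro e he
    induction he with
    | base i =>
      refine ⟨(SubData.unit F).el i, ?_, ?_⟩
      · have := (SubData.gen F).incl_lift F (fun e => CwF.Clo.base e)
        conv_rhs => rw [← this]
        cases i <;> rfl
      · have := congrArg (fun M => CwFHom.el M i) h
        cases i <;> exact this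
    | step hs _ _ _ h₁ h₂ h₃ =>
      obtain ⟨e₁, r₁, k₁⟩ := h₁
      obtain ⟨e₂, r₂, k₂⟩ := h₂
      obtain ⟨e₃, r₃, k₃⟩ := h₃
      obtain ⟨e', hst⟩ := (SubData.gen F).step_lift (e₁ := e₁) (e₂ := e₂) (e₃ := e₃) (by rw [r₁, r₂, r₃]; exact hs)
      refine ⟨e', ?_, ?_⟩
      · have := (SubData.gen F).incl.step_map hst
        rw [r₁, r₂, r₃] at this
        exact this.functional hs
      · have hK := K.step_map hst
        have hL := L.step_map hst
        rw [k₁, k₂, k₃] at hK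
        exact hK.functional hL
  apply CwFHom.ext_el
  intro e
  obtain ⟨e', h1, h2⟩ := main _ ((SubData.gen F).incl_good e)
  rw [(SubData.gen F).incl_inj _ _ h1] at h2
  exact h2

theorem CwF.exists_quotient (C : CwF.{u, u, u, u}) {Γ : C.Ctx} {A : C.Ty Γ} (a a' : C.Tm Γ A) :
    ∃ (Q : CwF.{u, u, u, u}) (η : CwFHom C Q), η.mapTm a = η.mapTm a' ∧
      ∀ (D : CwF.{u, u, u, u}) (F : CwFHom C D), F.mapTm a = F.mapTm a' →
        ∃! K : CwFHom Q D, K.comp η = F := by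
  let J : Type (u + 1) := Σ D : CwF.{u, u, u, u}, {F : CwFHom C D // F.mapTm a = F.mapTm a'}
  let F : CwFHom C (CwF.prod_s12 fun j : J => j.1) := CwFHom.tuple _ fun j => j.2.1
  have hF : F.mapTm a = F.mapTm a' := funext fun j => j.2.2
  have hu : (SubData.gen F).incl.comp (SubData.unit F) = F := SubData.incl_lift _ _ _
  refine ⟨(SubData.gen F).toCwF, SubData.unit F, ?_, ?_⟩
  · have : (SubData.unit F).el (.tm a) = (SubData.unit F).el (.tm a') := by
      apply SubData.incl_inj
      have h : F.el (.tm a) = F.el (.tm a') := by simp only [CwFHom.el, hF]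
      rw [← hu] at h
      exact h
    simpa [CwFHom.el] using this
  · intro D E hE
    refine ⟨(CwFHom.proj _ (⟨D, E, hE⟩ : J)).comp (SubData.gen F).incl, ?_, ?_⟩
    · have : (CwFHom.proj _ (⟨D, E, hE⟩ : J)).comp
          ((SubData.gen F).incl.comp (SubData.unit F)) = E := by rw [hu]; rfl
      exact this
    · intro K hK
      apply SubData.gen_unique
      rw [hK]
      have : (CwFHom.proj _ (⟨D, E, hE⟩ : J)).comp
          ((SubData.gen F).incl.comp (SubData.unit F)) = E := by rw [hu]; rfl
      exact this.symm

theorem SigCat.Valid.mor_comp {S : SigCat.{u}} (hS : S.Valid) : ∀ {C D E : S.Obj}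
    (F : CwFHom (S.cwf D) (S.cwf E)) (G : CwFHom (S.cwf C) (S.cwf D)),
    S.Mor D E F → S.Mor C D G → S.Mor C E (F.comp G) := by
  induction hS with
  | empty => intros; trivial
  | addSort S Γ _ ih =>
    intro C D E F G hF hG
    exact ⟨ih F G hF.1 hG.1, (F.mapTy_heq (Γ.uniform G hG.1) hG.2).trans hF.2⟩
  | addOp S Γ A _ ih =>
    intro C D E F G hF hG
    exact ⟨ih F G hF.1 hG.1,
      (F.mapTm_heq (Γ.uniform G hG.1) (A.uniform G hG.1) hG.2).trans hF.2⟩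
  | addEq S Γ A a a' _ ih =>
    intro C D E F G hF hG
    exact ih F G hF hG

theorem SigCat.Valid.mor_cancel {S : SigCat.{u}} (hS : S.Valid) : ∀ {C D E : S.Obj}
    (F : CwFHom (S.cwf D) (S.cwf E)) (G : CwFHom (S.cwf C) (S.cwf D)),
    S.Mor C D G → S.Mor C E (F.comp G) → S.Mor D E F := by
  induction hS with
  | empty => intros; trivial
  | addSort S Γ _ ih =>
    intro C D E F G hG hF
    exact ⟨ih F G hG.1 hF.1, (F.mapTy_heq (Γ.uniform G hG.1) hG.2).symm.trans hF.2⟩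
  | addOp S Γ A _ ih =>
    intro C D E F G hG hF
    exact ⟨ih F G hG.1 hF.1,
      (F.mapTm_heq (Γ.uniform G hG.1) (A.uniform G hG.1) hG.2).symm.trans hF.2⟩
  | addEq S Γ A a a' _ ih =>
    intro C D E F G hG hF
    exact ih F G hG hF

theorem SigCat.Valid.push {S : SigCat.{u}} (hS : S.Valid) : ∀ (C : S.Obj) (D : CwF.{u, u, u, u})
    (F : CwFHom (S.cwf C) D), ∃ (D' : S.Obj) (h : D = S.cwf D'), S.Mor C D' (h ▸ F) := by
  induction hS with
  | empty => intro C D F; exact ⟨D, rfl, trivial⟩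
  | addSort S Γ _ ih =>
    rintro ⟨C, c⟩ D F
    obtain ⟨D', rfl, hM⟩ := ih C D F
    have hΓ := Γ.uniform F hM
    refine ⟨⟨D', cast (by rw [← hΓ]) (F.mapTy c)⟩, rfl, hM, (cast_heq _ _).symm⟩
  | addOp S Γ A _ ih =>
    rintro ⟨C, c⟩ D F
    obtain ⟨D', rfl, hM⟩ := ih C D F
    have hΓ := Γ.uniform F hM
    have hA := A.uniform F hM
    have key : ∀ (X Y : (S.cwf D').Ctx) (_ : X = Y) (B : (S.cwf D').Ty X) (B' : (S.cwf D').Ty Y)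
        (_ : HEq B B') (b : (S.cwf D').Tm X B), ∃ b' : (S.cwf D').Tm Y B', HEq b b' := by
      intro X Y h B B' h' b
      subst h; cases h'; exact ⟨b, HEq.rfl⟩
    obtain ⟨b', hb'⟩ := key _ _ hΓ _ _ hA (F.mapTm c)
    exact ⟨⟨D', b'⟩, rfl, hM, hb'⟩
  | addEq S Γ A a a' _ ih =>
    rintro ⟨C, c⟩ D F
    obtain ⟨D', rfl, hM⟩ := ih C D F
    refine ⟨⟨D', eq_of_heq ?_⟩, rfl, hM⟩
    refine (a.uniform F hM).symm.trans ?_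
    rw [c]
    exact a'.uniform F hM

/-- Equation-extension step of the initiality theorem: if `CwF_Σ` has an
initial object then so does `CwF_{Σ'}` for `Σ' = (Σ,(Γ,A,a,a'))`, the full
subcategory of `CwF_Σ` on the objects `C` with `a_C = a'_C`. -/
theorem addEq_has_initial (S : SigCat.{u}) (hS : S.Valid)
    (hI : ∃ I : S.Obj, S.IsInitial I) (Γ : UnifCtx S) (A : UnifTy S Γ)
    (a a' : UnifTm S Γ A) :
    ∃ I' : (S.addEq Γ A a a').Obj, (S.addEq Γ A a a').IsInitial I' := by
  obtain ⟨I, hI⟩ := hI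
  obtain ⟨Q, η, hη, huniv⟩ := CwF.exists_quotient (S.cwf I) (a.fam I) (a'.fam I)
  obtain ⟨I', rfl, hM⟩ := hS.push I Q η
  have hI' : a.fam I' = a'.fam I' := by
    apply eq_of_heq
    refine (a.uniform η hM).symm.trans ?_
    rw [hη]
    exact a'.uniform η hM
  refine ⟨⟨I', hI'⟩, ?_⟩
  rintro ⟨E, hE⟩
  obtain ⟨F, hF, hFu⟩ := hI E
  have hFa : F.mapTm (a.fam I) = F.mapTm (a'.fam I) := by
    apply eq_of_heq
    refine (a.uniform F hF).trans ?_
    rw [hE]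
    exact (a'.uniform F hF).symm
  obtain ⟨K, hK, hKu⟩ := huniv _ F hFa
  refine ⟨K, hS.mor_cancel K η hM (by rw [hK]; exact hF), ?_⟩
  intro L hL
  exact hKu L (hFu _ (hS.mor_comp L η hL hM))
end

section
/- (Internal cwfs in Set are small cwfs.) Structures for the generalized algebraic theory of cwfs on the cwf Set of small sets are in bijective correspondence with small cwfs. Precisely, the data of a small set of objects ctx, small hom-sets hom(Δ,Γ) with identities and associative unital composition, small sets ty(Γ) for Γ ∈ ctx and tm(Γ,A) for A ∈ ty(Γ), substitution operations A[γ] and a[γ] satisfying A[id] = A, a[id] = a, A[γ∘δ] = A[γ][δ], a[γ∘δ] = a[γ][δ], an element 1 ∈ ctx with maps ⟨⟩_Γ ∈ hom(Γ,1) satisfying id_1 = ⟨⟩_1 and ⟨⟩_Γ∘γ = ⟨⟩_Δ, and comprehension data Γ.A ∈ ctx, ⟨γ,a⟩ ∈ hom(Δ,Γ.A), p ∈ hom(Γ.A,Γ), q ∈ tm(Γ.A,A[p]) satisfying p∘⟨γ,a⟩ = γ, q[⟨γ,a⟩] = a, ⟨γ,a⟩∘δ = ⟨γ∘δ,a[δ]⟩,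 and id_{Γ.A} = ⟨p,q⟩, corresponds bijectively to the data of a small category with families, i.e., a cwf whose sets of objects, morphisms, types, and terms are small. -/
universe u v w x u' v' w' x'

/-- The data obtained by interpreting the generalized algebraic theory of cwfs
in the cwf `Set` of small sets: a small set `ctx` of objects, small hom-sets
with identities and associative unital composition, small sets `ty Γ` and
`tm Γ A` with substitution operations satisfying the functoriality equations,
an element `1` with maps `⟨⟩_Γ` satisfying `id_1 = ⟨⟩_1` and `⟨⟩_Γ ∘ γ = ⟨⟩_Δ`,
and comprehension data satisfying `p∘⟨γ,a⟩ = γ`, `q[⟨γ,a⟩] = a`,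
`⟨γ,a⟩∘δ = ⟨γ∘δ, a[δ]⟩` and `id_{Γ.A} = ⟨p,q⟩`. -/
structure SetCwFStr : Type (u + 1) where
  ctx : Type u
  hom : ctx → ctx → Type u
  id : (Γ : ctx) → hom Γ Γ
  comp : {Ξ Δ Γ : ctx} → hom Δ Γ → hom Ξ Δ → hom Ξ Γ
  id_comp : ∀ {Δ Γ : ctx} (γ : hom Δ Γ), comp (id Γ) γ = γ
  comp_id : ∀ {Δ Γ : ctx} (γ : hom Δ Γ), comp γ (id Δ) = γ
  comp_assoc : ∀ {Θ Ξ Δ Γ : ctx} (γ : hom Δ Γ) (δ : hom Ξ Δ) (ξ : hom Θ Ξ),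
    comp (comp γ δ) ξ = comp γ (comp δ ξ)
  ty : ctx → Type u
  tm : (Γ : ctx) → ty Γ → Type u
  subTy : {Δ Γ : ctx} → ty Γ → hom Δ Γ → ty Δ
  subTm : {Δ Γ : ctx} → {A : ty Γ} → tm Γ A → (γ : hom Δ Γ) → tm Δ (subTy A γ)
  subTy_id : ∀ {Γ : ctx} (A : ty Γ), subTy A (id Γ) = A
  subTm_id : ∀ {Γ : ctx} {A : ty Γ} (a : tm Γ A), HEq (subTm a (id Γ)) a
  subTy_comp : ∀ {Ξ Δ Γ : ctx} (A : ty Γ) (γ : hom Δ Γ) (δ : hom Ξ Δ),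
    subTy A (comp γ δ) = subTy (subTy A γ) δ
  subTm_comp : ∀ {Ξ Δ Γ : ctx} {A : ty Γ} (a : tm Γ A) (γ : hom Δ Γ) (δ : hom Ξ Δ),
    HEq (subTm a (comp γ δ)) (subTm (subTm a γ) δ)
  one : ctx
  bang : (Γ : ctx) → hom Γ one
  id_one : id one = bang one
  bang_comp : ∀ {Δ Γ : ctx} (γ : hom Δ Γ), comp (bang Γ) γ = bang Δ
  ext : (Γ : ctx) → ty Γ → ctx
  pair : {Δ Γ : ctx} → (A : ty Γ) → (γ : hom Δ Γ) → tm Δ (subTy A γ) → hom Δ (ext Γ A)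
  p : {Γ : ctx} → (A : ty Γ) → hom (ext Γ A) Γ
  q : {Γ : ctx} → (A : ty Γ) → tm (ext Γ A) (subTy A (p A))
  p_pair : ∀ {Δ Γ : ctx} (A : ty Γ) (γ : hom Δ Γ) (a : tm Δ (subTy A γ)),
    comp (p A) (pair A γ a) = γ
  q_pair : ∀ {Δ Γ : ctx} (A : ty Γ) (γ : hom Δ Γ) (a : tm Δ (subTy A γ)),
    HEq (subTm (q A) (pair A γ a)) a
  pair_comp : ∀ {Ξ Δ Γ : ctx} (A : ty Γ) (γ : hom Δ Γ) (a : tm Δ (subTy A γ))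
    (δ : hom Ξ Δ),
    comp (pair A γ a) δ =
      pair A (comp γ δ) (cast (congrArg (tm Ξ) (subTy_comp A γ δ)).symm (subTm a δ))
  id_ext : ∀ {Γ : ctx} (A : ty Γ), id (ext Γ A) = pair A (p A) (q A)

theorem CwF.subTm_congr (C : CwF.{u, v, w, x}) {Δ Γ : C.Ctx} {A B : C.Ty Γ} (h : A = B)
    (a : C.Tm Γ A) (b : C.Tm Γ B) (hab : HEq a b) (γ : C.Hom Δ Γ) :
    HEq (C.subTm a γ) (C.subTm b γ) := by
  subst h
  cases hab
  rfl

/-- The small cwf given by a structure on `Set`. -/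
def SetCwFStr.toCwF (s : SetCwFStr.{u}) : CwF.{u, u, u, u} where
  Ctx := s.ctx
  Hom := s.hom
  id := s.id
  comp := s.comp
  id_comp := s.id_comp
  comp_id := s.comp_id
  comp_assoc := s.comp_assoc
  Ty := s.ty
  Tm := s.tm
  subTy := s.subTy
  subTm := s.subTm
  subTy_id := s.subTy_id
  subTy_comp := s.subTy_comp
  subTm_id := s.subTm_id
  subTm_comp := s.subTm_comp
  one := s.one
  bang := s.bang
  bang_unique := fun {Γ} γ => by
    rw [← s.bang_comp γ, ← s.id_one, s.id_comp]
  ext := s.ext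
  p := s.p
  q := s.q
  pair := s.pair
  p_pair := s.p_pair
  q_pair := s.q_pair
  pair_unique := fun {Δ Γ} A γ a δ h1 h2 => by
    subst h1
    have h := s.pair_comp A (s.p A) (s.q A) δ
    rw [← s.id_ext, s.id_comp] at h
    refine h.trans (congrArg _ ?_)
    exact eq_of_heq ((cast_heq _ _).trans h2)

/-- The structure on `Set` given by a small cwf. -/
def CwF.toStr (C : CwF.{u, u, u, u}) : SetCwFStr.{u} where
  ctx := C.Ctx
  hom := C.Hom
  id := C.id
  comp := C.comp
  id_comp := C.id_comp
  comp_id := C.comp_id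
  comp_assoc := C.comp_assoc
  ty := C.Ty
  tm := C.Tm
  subTy := C.subTy
  subTm := C.subTm
  subTy_id := C.subTy_id
  subTy_comp := C.subTy_comp
  subTm_id := C.subTm_id
  subTm_comp := C.subTm_comp
  one := C.one
  bang := C.bang
  id_one := C.bang_unique _
  bang_comp := fun _ => C.bang_unique _
  ext := C.ext
  p := C.p
  q := C.q
  pair := C.pair
  p_pair := C.p_pair
  q_pair := C.q_pair
  pair_comp := fun {Ξ Δ Γ} A γ a δ => by
    apply C.pair_unique
    · rw [← C.comp_assoc, C.p_pair]
    · refine (C.subTm_comp _ _ _).trans (HEq.trans ?_ (cast_heq _ _).symm)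
      apply C.subTm_congr _ _ _ (C.q_pair A γ a)
      rw [← C.subTy_comp, C.p_pair]
  id_ext := fun {Γ} A => C.pair_unique _ _ _ _ (C.comp_id _) (C.subTm_id _)

/-- Internal cwfs in `Set` are small cwfs: structures for the generalized
algebraic theory of cwfs on the cwf `Set` correspond bijectively to small
categories with families, the correspondence preserving all the data (objects,
morphisms, identities, composition, types, terms, substitution, terminal
object, terminal maps, comprehension, projections and pairing). -/
theorem setCwFStr_bijective_smallCwF :
    ∃ f : SetCwFStr.{u} → CwF.{u, u, u, u},
      Function.Bijective f ∧
      ∀ s : SetCwFStr.{u},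
        (f s).Ctx = s.ctx ∧
        HEq (f s).Hom s.hom ∧
        HEq (f s).id s.id ∧
        HEq (@CwF.comp (f s)) (@SetCwFStr.comp s) ∧
        HEq (f s).Ty s.ty ∧
        HEq (f s).Tm s.tm ∧
        HEq (@CwF.subTy (f s)) (@SetCwFStr.subTy s) ∧
        HEq (@CwF.subTm (f s)) (@SetCwFStr.subTm s) ∧
        HEq (f s).one s.one ∧
        HEq (f s).bang s.bang ∧
        HEq (f s).ext s.ext ∧
        HEq (@CwF.p (f s)) (@SetCwFStr.p s) ∧
        HEq (@CwF.q (f s)) (@SetCwFStr.q s) ∧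
        HEq (@CwF.pair (f s)) (@SetCwFStr.pair s) := by
  refine ⟨SetCwFStr.toCwF, Function.bijective_iff_has_inverse.mpr
    ⟨CwF.toStr, fun _ => rfl, fun _ => rfl⟩, fun s => ?_⟩
  exact ⟨rfl, HEq.rfl, HEq.rfl, HEq.rfl, HEq.rfl, HEq.rfl, HEq.rfl, HEq.rfl, HEq.rfl,
    HEq.rfl, HEq.rfl, HEq.rfl, HEq.rfl, HEq.rfl⟩
end
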